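/- Let n ≥ 3, ε ∈ {−1,1}^n, u, v ∈ ℂ, and let V ⊆ ℝ^n be an open set such that V ∩ {x_n = 0} is nonempty and connected. Let D be a differential operator of the form D f := Σ_{|α| ≤ N} a_α · (∂^α f)|_{V∩{x_n=0}} (α ranging over multi-indices in ℕ^n), where each a_α is a smooth ℂ-valued function on V ∩ {x_n = 0}. Assume that for every conformal Killing pair (Z,ρ) on V with signature ε tangent to {x_n = 0}, every smooth f : V → ℂ and every x ∈ V with x_n = 0: D(Σ_{j=1}^n Z_j ∂_j f + (u/2) ρ f)(x) = Σ_{j=1}^{n−1} Z_j(x) ∂_j(D f)(x) + (v/2) ρ(x) (D f)(x). Then either D f = 0 for all smooth f on V, or v − u ∈ ℕ and there exists c ∈ ℂ, c ≠ 0, such that D f(x) = c · (𝒟^μ_ℓ[ε] f)(x) for all smooth f : V → ℂ and all x ∈ V ∩ {x_n = 0}, where ℓ = v − u and μ = u − (n−1)/2. (Scalar case of the automatic continuity Theorem A combined with the classification: every locally defined conformal symmetry breaking operator extends to the whole space and is a multiple of a Juhl operator.) -/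

import Mathlib

open scoped BigOperators

noncomputable section

def pd {n : ℕ} {E : Type} [NormedAddCommGroup E] [NormedSpace ℝ E]
    (j : Fin n) (f : (Fin n → ℝ) → E) : (Fin n → ℝ) → E :=
  fun x => fderiv ℝ f x (Pi.single j 1)

def akCoeff (μ : ℂ) (ℓ k : ℕ) : ℂ :=
  ((-1 : ℂ) ^ k * 2 ^ (ℓ - 2 * k) / (Nat.factorial k * Nat.factorial (ℓ - 2 * k))) *
    ∏ j ∈ Finset.Ico ((ℓ + 1) / 2) (ℓ - k), (μ + (j : ℂ))

def sLap {n : ℕ} (ε : Fin n → ℝ) (i₀ : Fin n) (f : (Fin n → ℝ) → ℂ) : (Fin n → ℝ) → ℂ :=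
  fun x => (-(ε i₀ : ℂ)) * ∑ j ∈ Finset.univ.erase i₀, (ε j : ℂ) * pd j (pd j f) x

def juhlOp {n : ℕ} (ε : Fin n → ℝ) (i₀ : Fin n) (μ : ℂ) (ℓ : ℕ)
    (f : (Fin n → ℝ) → ℂ) : (Fin n → ℝ) → ℂ :=
  fun x => ∑ k ∈ Finset.range (ℓ / 2 + 1),
    akCoeff μ ℓ k * ((sLap ε i₀)^[k] ((pd i₀)^[ℓ - 2 * k] f)) x

def juhlSymbol {n : ℕ} (ε : Fin n → ℝ) (i₀ : Fin n) (μ : ℂ) (ℓ : ℕ) :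
    MvPolynomial (Fin n) ℂ :=
  ∑ k ∈ Finset.range (ℓ / 2 + 1),
    MvPolynomial.C (akCoeff μ ℓ k) *
      (MvPolynomial.C (-(ε i₀ : ℂ)) *
        ∑ j ∈ Finset.univ.erase i₀, MvPolynomial.C ((ε j : ℂ)) * MvPolynomial.X j ^ 2) ^ k *
      MvPolynomial.X i₀ ^ (ℓ - 2 * k)

def monoDiff {n : ℕ} (m : Fin n → ℕ) (f : (Fin n → ℝ) → ℂ) : (Fin n → ℝ) → ℂ :=
  (List.finRange n).foldr (fun j g => (pd j)^[m j] g) f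

def polyDiff {n : ℕ} (P : MvPolynomial (Fin n) ℂ) (f : (Fin n → ℝ) → ℂ) :
    (Fin n → ℝ) → ℂ :=
  fun x => ∑ m ∈ P.support, P.coeff m * monoDiff (fun j => m j) f x

def IsConformalKillingPair {n : ℕ} (ε : Fin n → ℝ) (V : Set (Fin n → ℝ))
    (Z : (Fin n → ℝ) → (Fin n → ℝ)) (ρ : (Fin n → ℝ) → ℝ) : Prop :=
  ContDiffOn ℝ (⊤ : ℕ∞) Z V ∧ ContDiffOn ℝ (⊤ : ℕ∞) ρ V ∧
    ∀ i j : Fin n, ∀ x ∈ V,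
      ε i * pd j (fun y => Z y i) x + ε j * pd i (fun y => Z y j) x
        = ρ x * ε i * (if i = j then 1 else 0)

def IsCovariantSymbol {n : ℕ} (ε : Fin n → ℝ) (i₀ : Fin n) (u v : ℂ)
    (P : MvPolynomial (Fin n) ℂ) : Prop :=
  ∀ (Z : (Fin n → ℝ) → (Fin n → ℝ)) (ρ : (Fin n → ℝ) → ℝ),
    IsConformalKillingPair ε Set.univ Z ρ →
    (∀ x : Fin n → ℝ, x i₀ = 0 → Z x i₀ = 0) →
    ∀ f : (Fin n → ℝ) → ℂ, ContDiff ℝ (⊤ : ℕ∞) f →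
    ∀ x : Fin n → ℝ, x i₀ = 0 →
      polyDiff P (fun y => (∑ j, (Z y j : ℂ) * pd j f y) + u / 2 * (ρ y : ℂ) * f y) x
        = (∑ j ∈ Finset.univ.erase i₀, (Z x j : ℂ) * pd j (polyDiff P f) x)
          + v / 2 * (ρ x : ℂ) * polyDiff P f x

/-- The finite set of multi-indices `m : Fin n → ℕ` of total degree `|m| ≤ N`. -/
def multiIdx (n N : ℕ) : Finset (Fin n → ℕ) :=
  (Finset.Iic (fun _ => N)).filter (fun m => ∑ j, m j ≤ N)

section Helpers
open MvPolynomial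


/-- Bilinear Fischer pairing. -/
def FlL (n : ℕ) : MvPolynomial (Fin n) ℂ →ₗ[ℂ] (MvPolynomial (Fin n) ℂ →ₗ[ℂ] ℂ) :=
  (basisMonomials (Fin n) ℂ).constr ℂ
    (fun m => ((∏ j, ((m j).factorial : ℂ)) • lcoeff ℂ m))

theorem FlL_monomial {n : ℕ} (m : Fin n →₀ ℕ) (a : ℂ) (f : MvPolynomial (Fin n) ℂ) :
    FlL n (monomial m a) f = a * ((∏ j, ((m j).factorial : ℂ)) * coeff m f) := by
  have h : monomial m a = a • (basisMonomials (Fin n) ℂ) m := by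
    simp [smul_monomial]
  rw [h, map_smul, FlL, Module.Basis.constr_basis]
  simp [lcoeff]

theorem FlL_apply {n : ℕ} (P f : MvPolynomial (Fin n) ℂ) :
    FlL n P f = ∑ m ∈ P.support, P.coeff m * ((∏ j, ((m j).factorial : ℂ)) * coeff m f) := by
  conv_lhs => rw [P.as_sum]
  rw [map_sum, LinearMap.sum_apply]
  simp only [FlL_monomial]

theorem FlL_right {n : ℕ} (P : MvPolynomial (Fin n) ℂ) (m : Fin n →₀ ℕ) :
    FlL n P (monomial m 1) = (∏ j, ((m j).factorial : ℂ)) * coeff m P := by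
  rw [FlL_apply]
  simp only [coeff_monomial]
  by_cases h : m ∈ P.support
  · rw [Finset.sum_eq_single m]
    · simp; ring
    · intro b _ hb; simp [hb.symm]
    · intro h'; exact absurd h h'
  · rw [Finset.sum_eq_zero]
    · simp at h; simp [h]
    · intro b hb
      have : m ≠ b := by rintro rfl; exact h hb
      simp [this]

theorem prodfac_ne {n : ℕ} (m : Fin n →₀ ℕ) : (∏ j, ((m j).factorial : ℂ)) ≠ 0 := by
  rw [Finset.prod_ne_zero_iff]; intro j _; exact_mod_cast Nat.factorial_ne_zero _

theorem cast_succ_ne (k : ℕ) : (k : ℂ) + 1 ≠ 0 := by exact_mod_cast Nat.succ_ne_zero k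

theorem prodfac_succ {n : ℕ} (m : Fin n →₀ ℕ) (i : Fin n) :
    (∏ j, (((m + Finsupp.single i 1 : Fin n →₀ ℕ) j).factorial : ℂ))
      = (∏ j, ((m j).factorial : ℂ)) * ((m i : ℂ) + 1) := by
  rw [← Finset.mul_prod_erase _ _ (Finset.mem_univ i),
    ← Finset.mul_prod_erase _ (fun j => ((m j).factorial : ℂ)) (Finset.mem_univ i)]
  have : ∀ j ∈ Finset.univ.erase i,
      (((m + Finsupp.single i 1 : Fin n →₀ ℕ) j).factorial : ℂ) = ((m j).factorial : ℂ) := by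
    intro j hj
    have : j ≠ i := Finset.ne_of_mem_erase hj
    simp [this.symm]
  rw [Finset.prod_congr rfl this]
  simp [Nat.factorial_succ]
  ring

theorem lin_ext {n : ℕ} (L L' : MvPolynomial (Fin n) ℂ →ₗ[ℂ] ℂ)
    (h : ∀ m, L (monomial m 1) = L' (monomial m 1)) : L = L' := by
  apply (basisMonomials (Fin n) ℂ).ext
  intro m; simpa using h m

theorem FlL_inj {n : ℕ} (P : MvPolynomial (Fin n) ℂ) (h : FlL n P = 0) : P = 0 := by
  ext m
  have := FlL_right P m
  rw [h] at this
  simp at this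
  rcases this with h1 | h1
  · exact absurd h1 (by simpa using prodfac_ne m)
  · simpa using h1

theorem FlL_X_mul {n : ℕ} (P f : MvPolynomial (Fin n) ℂ) (i : Fin n) :
    FlL n P (X i * f) = FlL n (pderiv i P) f := by
  have : (FlL n P).comp (LinearMap.mulLeft ℂ (X i)) = FlL n (pderiv i P) := by
    apply lin_ext
    intro m
    have h : X i * monomial m (1:ℂ) = monomial (m + Finsupp.single i 1) 1 := by
      rw [X, monomial_mul]; simp [add_comm]
    simp only [LinearMap.comp_apply, LinearMap.mulLeft_apply]
    rw [h, FlL_right, FlL_right, coeff_pderiv, prodfac_succ]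
    ring
  exact congrArg (fun L => L f) this

theorem FlL_symm {n : ℕ} (P f : MvPolynomial (Fin n) ℂ) : FlL n P f = FlL n f P := by
  have : FlL n P = (FlL n).flip P := by
    apply lin_ext
    intro m
    rw [LinearMap.flip_apply, FlL_right, FlL_monomial]; ring
  rw [this]; rfl

theorem FlL_pderiv {n : ℕ} (P f : MvPolynomial (Fin n) ℂ) (i : Fin n) :
    FlL n P (pderiv i f) = FlL n (X i * P) f := by
  rw [FlL_symm, ← FlL_X_mul, FlL_symm]

theorem C_mul_smul {n : ℕ} (c : ℂ) (f : MvPolynomial (Fin n) ℂ) : C c * f = c • f := by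
  rw [smul_eq_C_mul]

/-- The invariance conditions on a linear functional. -/
structure CovFun {n : ℕ} (ε : Fin n → ℝ) (d : Fin n) (u : ℂ) (l : ℂ)
    (L : MvPolynomial (Fin n) ℂ →ₗ[ℂ] ℂ) : Prop where
  eul : ∀ f, L (∑ j, X j * pderiv j f) = l * L f
  rot : ∀ i j, i ≠ d → j ≠ d → i ≠ j → ∀ f,
    L ((ε i : ℂ) • (X i * pderiv j f) - (ε j : ℂ) • (X j * pderiv i f)) = 0
  spec : ∀ i, i ≠ d → ∀ f,
    L ((2 * ε i : ℂ) • (X i * ∑ j, X j * pderiv j f)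
      - (∑ j, (ε j : ℂ) • (X j * (X j * pderiv i f))) + (2 * u * ε i) • (X i * f)) = 0

theorem CovFun.sub_smul {n : ℕ} {ε : Fin n → ℝ} {d : Fin n} {u l : ℂ}
    {L L' : MvPolynomial (Fin n) ℂ →ₗ[ℂ] ℂ} (h : CovFun ε d u l L) (h' : CovFun ε d u l L')
    (t : ℂ) : CovFun ε d u l (L - t • L') where
  eul f := by
    rw [LinearMap.sub_apply, LinearMap.smul_apply, h.eul, h'.eul]
    simp; ring
  rot i j hi hj hij f := by
    rw [LinearMap.sub_apply, LinearMap.smul_apply, h.rot i j hi hj hij, h'.rot i j hi hj hij]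
    simp
  spec i hi f := by
    rw [LinearMap.sub_apply, LinearMap.smul_apply, h.spec i hi, h'.spec i hi]
    simp

theorem eul_monomial {n : ℕ} (m : Fin n →₀ ℕ) :
    ∑ j, X j * pderiv j (monomial m (1:ℂ)) = ((m.degree : ℕ) : ℂ) • monomial m (1:ℂ) := by
  have := (isHomogeneous_monomial (R := ℂ) (d := m) (n := m.degree) 1 rfl).sum_X_mul_pderiv
  rw [this, Nat.cast_smul_eq_nsmul]

theorem X_mul_mon {n : ℕ} (m : Fin n →₀ ℕ) (i : Fin n) (a : ℂ) :
    X i * monomial m a = monomial (m + Finsupp.single i 1) a := by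
  rw [X, monomial_mul]; simp [add_comm]

theorem pderiv_mon_succ {n : ℕ} (m : Fin n →₀ ℕ) (i : Fin n) :
    pderiv i (monomial (m + Finsupp.single i 1) (1:ℂ)) = ((m i : ℂ) + 1) • monomial m 1 := by
  rw [pderiv_monomial]; simp [smul_monomial]

theorem pderiv_mon_zero {n : ℕ} (m : Fin n →₀ ℕ) (i : Fin n) (h : m i = 0) :
    pderiv i (monomial m (1:ℂ)) = 0 := by
  rw [pderiv_monomial]; simp [h]

section uniq
variable {n : ℕ} {ε : Fin n → ℝ} {d : Fin n} {u l : ℂ}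
    {L : MvPolynomial (Fin n) ℂ →ₗ[ℂ] ℂ}

theorem CovFun.H (h : CovFun ε d u l L) (m : Fin n →₀ ℕ) (hm : ((m.degree : ℕ) : ℂ) ≠ l) :
    L (monomial m 1) = 0 := by
  have := h.eul (monomial m 1)
  rw [eul_monomial, map_smul, smul_eq_mul, ← sub_eq_zero, ← sub_mul] at this
  rcases mul_eq_zero.1 this with h1 | h1
  · exact absurd (sub_eq_zero.1 h1) hm
  · exact h1

theorem CovFun.R1 (hε : ∀ j, ε j = 1 ∨ ε j = -1) (h : CovFun ε d u l L) (m : Fin n →₀ ℕ)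
    (i j : Fin n) (hi : i ≠ d) (hj : j ≠ d) (hij : i ≠ j) (hm : m i = 0) :
    L (monomial (m + Finsupp.single i 1) 1) = 0 := by
  have := h.rot i j hi hj hij (monomial (m + Finsupp.single j 1) 1)
  rw [pderiv_mon_succ, pderiv_mon_zero _ i (by simp [hm, hij.symm])] at this
  rw [mul_smul_comm, X_mul_mon] at this
  simp at this
  rcases this with h1 | h1 | h1
  · rcases hε i with h2 | h2 <;> rw [h2] at h1 <;> norm_num at h1
  · exact absurd h1 (cast_succ_ne _)
  · exact h1

theorem CovFun.R2 (h : CovFun ε d u l L) (m : Fin n →₀ ℕ)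
    (i j : Fin n) (hi : i ≠ d) (hj : j ≠ d) (hij : i ≠ j) :
    (ε i : ℂ) * ((m j : ℂ) + 1) * L (monomial (m + Finsupp.single i 2) 1)
     = (ε j : ℂ) * ((m i : ℂ) + 1) * L (monomial (m + Finsupp.single j 2) 1) := by
  have h2 : ∀ k : Fin n, m + Finsupp.single k 2 = m + Finsupp.single k 1 + Finsupp.single k 1 := by
    intro k; rw [add_assoc, ← Finsupp.single_add]
  have := h.rot i j hi hj hij (monomial (m + Finsupp.single i 1 + Finsupp.single j 1) 1)
  rw [pderiv_mon_succ, add_right_comm, pderiv_mon_succ] at this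
  rw [mul_smul_comm, mul_smul_comm, X_mul_mon, X_mul_mon, ← h2, ← h2, map_sub, map_smul, map_smul,
    map_smul, map_smul] at this
  simp [hij, hij.symm] at this
  linear_combination this

theorem CovFun.S2 (h : CovFun ε d u l L) (m : Fin n →₀ ℕ) (i : Fin n) (hi : i ≠ d) :
    2 * (ε i : ℂ) * ((m.degree : ℂ) + 1 + u) * L (monomial (m + Finsupp.single i 2) 1)
     = ((m i : ℂ) + 1) * ∑ j, (ε j : ℂ) * L (monomial (m + Finsupp.single j 2) 1) := by
  have h2 : ∀ k : Fin n, m + Finsupp.single k 2 = m + Finsupp.single k 1 + Finsupp.single k 1 := by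
    intro k; rw [add_assoc, ← Finsupp.single_add]
  have := h.spec i hi (monomial (m + Finsupp.single i 1) 1)
  rw [eul_monomial, pderiv_mon_succ] at this
  simp only [mul_smul_comm, X_mul_mon, ← h2, map_sub, map_add, map_smul, map_sum, smul_eq_mul] at this
  have h3 : (∑ j, (ε j : ℂ) * (((m i : ℂ) + 1) * L (monomial (m + Finsupp.single j 2) 1)))
     = ((m i : ℂ) + 1) * ∑ j, (ε j : ℂ) * L (monomial (m + Finsupp.single j 2) 1) := by
    rw [Finset.mul_sum]; apply Finset.sum_congr rfl; intros; ring
  rw [h3] at this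
  simp at this
  linear_combination this

theorem CovFun.odd (hε : ∀ j, ε j = 1 ∨ ε j = -1) (h : CovFun ε d u l L)
    (i j : Fin n) (hi : i ≠ d) (hj : j ≠ d) (hij : i ≠ j) (k : ℕ) :
    ∀ (m : Fin n →₀ ℕ) (_ : m i = 0), 
    L (monomial (m + Finsupp.single i (2 * k + 1)) 1) = 0 := by
  have he : ∀ i, (ε i : ℂ) ≠ 0 := by
    intro i; rcases hε i with h2 | h2 <;> rw [h2] <;> norm_num
  induction k with
  | zero => intro m hm; exact h.R1 hε m i j hi hj hij hm
  | succ k ih =>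
    intro m hm
    have h1 := h.R2 (m + Finsupp.single i (2 * k + 1)) i j hi hj hij
    rw [add_right_comm _ _ (Finsupp.single j 2), ih _ (by simp [hm, hij.symm])] at h1
    rw [add_assoc, ← Finsupp.single_add] at h1
    have h4 : ((m + Finsupp.single i (2 * k + 1)) j : ℂ) + 1 ≠ 0 := cast_succ_ne _
    rw [mul_zero] at h1
    rcases mul_eq_zero.1 h1 with h5 | h5
    · exact absurd h5 (mul_ne_zero (he i) h4)
    · exact h5

theorem CovFun.vanish (hε : ∀ j, ε j = 1 ∨ ε j = -1) (ℓ : ℕ) (h : CovFun ε d u ℓ L)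
    (i j : Fin n) (hi : i ≠ d) (hj : j ≠ d) (hij : i ≠ j)
    (h0 : L (monomial (Finsupp.single i (2 * (ℓ / 2)) + Finsupp.single d (ℓ % 2)) 1) = 0) :
    L = 0 := by
  have he : ∀ i, (ε i : ℂ) ≠ 0 := by
    intro i; rcases hε i with h2 | h2 <;> rw [h2] <;> norm_num
  have hs : ∀ k : ℕ, (k : ℂ) + 1 ≠ 0 := fun k => by exact_mod_cast Nat.succ_ne_zero k
  -- transfer
  have tr : ∀ m : Fin n →₀ ℕ, L (monomial (m + Finsupp.single i 2) 1) = 0 →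
      ∀ k, L (monomial (m + Finsupp.single k 2) 1) = 0 := by
    intro m hm
    have t1 : ∀ k, k ≠ d → L (monomial (m + Finsupp.single k 2) 1) = 0 := by
      intro k hk
      by_cases hki : k = i
      · rw [hki]; exact hm
      have h1 := h.R2 m k i hk hi hki
      rw [hm, mul_zero] at h1
      rcases mul_eq_zero.1 h1 with h5 | h5
      · exact absurd h5 (mul_ne_zero (he k) (hs _))
      · exact h5
    intro k
    by_cases hk : k = d
    · have h1 := h.S2 m i hi
      rw [hm, mul_zero, Finset.sum_eq_single d] at h1
      · rcases mul_eq_zero.1 h1.symm with h5 | h5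
        · exact absurd h5 (hs _)
        · rcases mul_eq_zero.1 h5 with h6 | h6
          · exact absurd h6 (he _)
          · rw [hk]; exact h6
      · intro b _ hb; rw [t1 b hb, mul_zero]
      · simp
    · exact t1 k hk
  have main : ∀ (N : ℕ) (m : Fin n →₀ ℕ), m.degree = ℓ → ℓ - m i = N → L (monomial m 1) = 0 := by
    intro N
    induction N using Nat.strong_induction_on with
    | _ N ih =>
    intro m hdeg hN
    have hle : m i ≤ m.degree := Finsupp.le_degree i m
    by_cases hk : ∃ k, k ≠ i ∧ 2 ≤ m k
    · obtain ⟨k, hki, hk2⟩ := hk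
      obtain ⟨m', rfl⟩ : ∃ m', m = m' + Finsupp.single k 2 :=
        ⟨m - Finsupp.single k 2, by
          rw [tsub_add_cancel_of_le]; rwa [Finsupp.single_le_iff]⟩
      apply tr
      have hd2 : (m' + Finsupp.single i 2).degree = ℓ := by
        rw [← hdeg]; simp
      have hle2 : (m' + Finsupp.single i 2 : Fin n →₀ ℕ) i ≤ (m' + Finsupp.single i 2).degree :=
        Finsupp.le_degree i _
      refine ih _ ?_ _ hd2 rfl
      rw [← hN]
      simp [hki] at *
      omega
    push Not at hk
    by_cases hodd : ∃ k, k ≠ d ∧ m k % 2 = 1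
    · obtain ⟨k, hkd, hk1⟩ := hodd
      obtain ⟨j', hj'd, hkj'⟩ : ∃ j', j' ≠ d ∧ k ≠ j' := by
        by_cases hki : k = i
        · exact ⟨j, hj, by rw [hki]; exact hij⟩
        · exact ⟨i, hi, hki⟩
      have := h.odd hε k j' hkd hj'd hkj' (m k / 2) (m.erase k) (by simp)
      rwa [show 2 * (m k / 2) + 1 = m k by omega, Finsupp.erase_add_single] at this
    push Not at hodd
    have hz : ∀ k, k ≠ i → k ≠ d → m k = 0 := by
      intro k h1 h2
      have := hk k h1; have := hodd k h2; omega
    have hm : m = Finsupp.single i (m i) + Finsupp.single d (m d) := by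
      ext k
      by_cases h1 : k = i
      · subst h1; simp [hi.symm]
      · by_cases h2 : k = d
        · subst h2; simp [hi]
        · simp [hz k h1 h2, Ne.symm h1, Ne.symm h2]
    have hsum : m i + m d = ℓ := by
      rw [← hdeg]; conv_rhs => rw [hm]
      simp
    have := hodd i hi
    have := hk d hi.symm
    rw [hm, show m i = 2 * (ℓ / 2) by omega, show m d = ℓ % 2 by omega]
    exact h0
  apply lin_ext
  intro m
  by_cases hm : m.degree = ℓ
  · simpa using main _ m hm rfl
  · simpa using h.H m (by exact_mod_cast hm)

end uniq


def lam {n : ℕ} (ε : Fin n → ℝ) (d : Fin n) : MvPolynomial (Fin n) ℂ :=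
  C (-(ε d : ℂ)) * ∑ j ∈ Finset.univ.erase d, C ((ε j : ℂ)) * X j ^ 2

theorem juhlSymbol_eq {n : ℕ} (ε : Fin n → ℝ) (d : Fin n) (μ : ℂ) (ℓ : ℕ) :
    juhlSymbol ε d μ ℓ = ∑ k ∈ Finset.range (ℓ / 2 + 1),
      C (akCoeff μ ℓ k) * lam ε d ^ k * X d ^ (ℓ - 2 * k) := rfl

theorem pderiv_lam {n : ℕ} (ε : Fin n → ℝ) (d i : Fin n) (hi : i ≠ d) :
    pderiv i (lam ε d) = C (-2 * (ε d : ℂ) * ε i) * X i := by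
  rw [lam, pderiv_C_mul, map_sum, Finset.sum_eq_single i]
  · rw [pderiv_C_mul, pderiv_pow, pderiv_X_self]
    simp only [C_mul, C_neg]
    rw [show (C 2 : MvPolynomial (Fin n) ℂ) = 2 from map_ofNat C 2]
    push_cast
    ring
  · intro b _ hb
    simp [pderiv_X_of_ne hb]
  · intro h; exact absurd (by simp [hi]) h

theorem pderiv_lam_d {n : ℕ} (ε : Fin n → ℝ) (d : Fin n) :
    pderiv d (lam ε d) = 0 := by
  rw [lam, pderiv_C_mul, map_sum, Finset.sum_eq_zero]
  · simp
  · intro b hb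
    have := Finset.ne_of_mem_erase hb
    simp [pderiv_X_of_ne this]

/-- the common factor of the tangential derivatives -/
def gfac {n : ℕ} (ε : Fin n → ℝ) (d : Fin n) (μ : ℂ) (ℓ : ℕ) : MvPolynomial (Fin n) ℂ :=
  ∑ k ∈ Finset.range (ℓ / 2 + 1),
      C (akCoeff μ ℓ k * k) * lam ε d ^ (k - 1) * X d ^ (ℓ - 2 * k)

theorem pderiv_juhl {n : ℕ} (ε : Fin n → ℝ) (d : Fin n) (μ : ℂ) (ℓ : ℕ) (i : Fin n) (hi : i ≠ d) :
    pderiv i (juhlSymbol ε d μ ℓ) = C (-2 * (ε d : ℂ) * ε i) * (X i * gfac ε d μ ℓ) := by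
  rw [juhlSymbol_eq, gfac, map_sum, Finset.mul_sum, Finset.mul_sum]
  apply Finset.sum_congr rfl
  intro k _
  rw [mul_assoc, pderiv_C_mul, pderiv_mul, pderiv_pow, pderiv_pow, pderiv_lam ε d i hi,
    pderiv_X_of_ne hi.symm]
  simp only [C_mul, map_natCast]
  ring

/-- homogeneity -/
theorem lam_hom {n : ℕ} (ε : Fin n → ℝ) (d : Fin n) : (lam ε d).IsHomogeneous 2 := by
  rw [lam]
  have : (2:ℕ) = 0 + 2 := rfl
  rw [this]
  refine (isHomogeneous_C _ _).mul (IsHomogeneous.sum _ _ _ fun j _ => ?_)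
  rw [this]
  exact (isHomogeneous_C _ _).mul (isHomogeneous_X_pow _ _)

theorem juhl_hom {n : ℕ} (ε : Fin n → ℝ) (d : Fin n) (μ : ℂ) (ℓ : ℕ) :
    (juhlSymbol ε d μ ℓ).IsHomogeneous ℓ := by
  rw [juhlSymbol_eq]
  refine IsHomogeneous.sum _ _ _ fun k hk => ?_
  have hk' : ℓ = 0 + 2 * k + (ℓ - 2 * k) := by
    have := Finset.mem_range.1 hk; omega
  have := ((isHomogeneous_C (Fin n) (akCoeff μ ℓ k)).mul ((lam_hom ε d).pow k)).mul
    (isHomogeneous_X_pow (R := ℂ) d (ℓ - 2 * k))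
  rwa [← hk'] at this

theorem akCoeff_rec (μ : ℂ) (ℓ k : ℕ) (hk : 2 * (k + 1) ≤ ℓ) :
    4 * ((k : ℂ) + 1) * (μ + ℓ - (k + 1)) * akCoeff μ ℓ (k + 1)
      = - (((ℓ - 2 * k : ℕ) : ℂ) * ((ℓ - 2 * k - 1 : ℕ) : ℂ)) * akCoeff μ ℓ k := by
  obtain ⟨r, rfl⟩ : ∃ r, ℓ = r + 2 * (k + 1) := ⟨ℓ - 2 * (k + 1), by omega⟩
  unfold akCoeff
  rw [show r + 2 * (k + 1) - 2 * (k + 1) = r by omega,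
    show r + 2 * (k + 1) - 2 * k = r + 2 by omega,
    show r + 2 - 1 = r + 1 by omega,
    show r + 2 * (k + 1) - (k + 1) = r + k + 1 by omega,
    show r + 2 * (k + 1) - k = r + k + 1 + 1 by omega,
    Finset.prod_Ico_succ_top (b := r + k + 1) (by omega)]
  have h1 : (Nat.factorial k : ℂ) ≠ 0 := by exact_mod_cast Nat.factorial_ne_zero k
  have h2 : (Nat.factorial r : ℂ) ≠ 0 := by exact_mod_cast Nat.factorial_ne_zero r
  have h3 := cast_succ_ne k
  have h4 := cast_succ_ne r
  have h5 : (r : ℂ) + 1 + 1 ≠ 0 := by exact_mod_cast cast_succ_ne (r + 1)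
  rw [Nat.factorial_succ k, Nat.factorial_succ (r + 1), Nat.factorial_succ r]
  push_cast
  field_simp
  ring

/-- the tangential part of the wave operator on powers of lam -/
theorem box_juhl {n : ℕ} (ε : Fin n → ℝ) (hε : ∀ j, ε j = 1 ∨ ε j = -1)
    (d : Fin n) (μ : ℂ) (ℓ : ℕ) :
    ∑ j ∈ Finset.univ.erase d, C (ε j : ℂ) * pderiv j (pderiv j (juhlSymbol ε d μ ℓ))
      = C (-2 * (ε d : ℂ)) * ∑ k ∈ Finset.range (ℓ / 2 + 1),
        C (akCoeff μ ℓ k * k * (2 * k + n - 3)) * lam ε d ^ (k - 1) * X d ^ (ℓ - 2 * k) := by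
  have he : ∀ i, (ε i : ℂ) * ε i = 1 := by
    intro i; rcases hε i with h2 | h2 <;> rw [h2] <;> norm_num
  have h1 : ∀ j ∈ Finset.univ.erase d,
      C (ε j : ℂ) * pderiv j (pderiv j (juhlSymbol ε d μ ℓ))
      = C (-2 * (ε d : ℂ)) * ∑ k ∈ Finset.range (ℓ / 2 + 1),
        (C (akCoeff μ ℓ k * k) * lam ε d ^ (k - 1) * X d ^ (ℓ - 2 * k)
        + C (akCoeff μ ℓ k * k * (2 * (k - 1 : ℕ))) *
          (lam ε d ^ (k - 1 - 1) * (C (-(ε d : ℂ)) * (C (ε j : ℂ) * X j ^ 2)))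
            * X d ^ (ℓ - 2 * k)) := by
    intro j hj
    have hj' := Finset.ne_of_mem_erase hj
    rw [pderiv_juhl _ _ _ _ _ hj', pderiv_C_mul, gfac, Finset.mul_sum, map_sum,
      Finset.mul_sum, Finset.mul_sum, Finset.mul_sum]
    apply Finset.sum_congr rfl
    intro k _
    rw [pderiv_mul, mul_assoc (C _) (lam ε d ^ _), pderiv_C_mul, pderiv_mul, pderiv_pow, pderiv_pow, pderiv_lam ε d j hj',
      pderiv_X_of_ne hj'.symm, pderiv_X_self]
    have hc : (C (ε j : ℂ) : MvPolynomial (Fin n) ℂ) * C (ε j : ℂ) = 1 := by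
      rw [← C_mul, he, C_1]
    simp only [C_mul, C_neg, map_natCast]
    rw [show (C 2 : MvPolynomial (Fin n) ℂ) = 2 from map_ofNat C 2]
    linear_combination (-2 * C (ε d : ℂ) * (C (akCoeff μ ℓ k) * k * lam ε d ^ (k - 1) * X d ^ (ℓ - 2 * k) + X j * C (akCoeff μ ℓ k) * k * (((k - 1 : ℕ) : MvPolynomial (Fin n) ℂ) * lam ε d ^ (k - 1 - 1) * (-2 * C (ε d : ℂ) * C (ε j : ℂ) * X j) * X d ^ (ℓ - 2 * k)))) * hc
  rw [Finset.sum_congr rfl h1, ← Finset.mul_sum, Finset.sum_comm]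
  congr 1
  apply Finset.sum_congr rfl
  intro k _
  have h2 : ∑ x ∈ Finset.univ.erase d,
        C (akCoeff μ ℓ k * ↑k * (2 * ↑(k - 1))) * (lam ε d ^ (k - 1 - 1) *
          (C (-(ε d : ℂ)) * (C (ε x : ℂ) * X x ^ 2))) * X d ^ (ℓ - 2 * k)
      = C (akCoeff μ ℓ k * ↑k * (2 * ↑(k - 1))) * (lam ε d ^ (k - 1 - 1) *
          lam ε d) * X d ^ (ℓ - 2 * k) := by
    conv_rhs => enter [1, 2, 2]; rw [lam]
    simp only [Finset.mul_sum, Finset.sum_mul]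
  rw [Finset.sum_add_distrib, h2]
  rw [Finset.sum_const, Finset.card_erase_of_mem (Finset.mem_univ d)]
  simp only [Finset.card_univ, Fintype.card_fin, nsmul_eq_mul]
  have hn : 1 ≤ n := by have := d.2; omega
  rcases k with _ | k
  · simp
  rcases k with _ | k
  · simp only [Nat.cast_sub hn, C_mul, C_add, C_sub, map_natCast]
    simp
    rw [show (C 2 : MvPolynomial (Fin n) ℂ) = 2 from map_ofNat C 2, show (C 3 : MvPolynomial (Fin n) ℂ) = 3 from map_ofNat C 3]
    ring
  · simp only [Nat.cast_sub hn, C_mul, C_add, C_sub, map_natCast]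
    simp
    rw [show (C 2 : MvPolynomial (Fin n) ℂ) = 2 from map_ofNat C 2, show (C 3 : MvPolynomial (Fin n) ℂ) = 3 from map_ofNat C 3]
    ring

theorem box_juhl_d {n : ℕ} (ε : Fin n → ℝ) 
    (d : Fin n) (μ : ℂ) (ℓ : ℕ) :
    pderiv d (pderiv d (juhlSymbol ε d μ ℓ))
      = ∑ k ∈ Finset.range (ℓ / 2 + 1),
        C (akCoeff μ ℓ k * ((ℓ - 2 * k : ℕ) * (ℓ - 2 * k - 1 : ℕ))) * lam ε d ^ k *
          X d ^ (ℓ - 2 * k - 2) := by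
  rw [juhlSymbol_eq, map_sum, map_sum]
  apply Finset.sum_congr rfl
  intro k _
  have h1 : pderiv d (C (akCoeff μ ℓ k) * lam ε d ^ k * X d ^ (ℓ - 2 * k))
      = C (akCoeff μ ℓ k * (ℓ - 2 * k : ℕ)) * (lam ε d ^ k * X d ^ (ℓ - 2 * k - 1)) := by
    rw [mul_assoc, pderiv_C_mul, pderiv_mul, pderiv_pow, pderiv_pow, pderiv_lam_d,
      pderiv_X_self]
    simp only [C_mul, map_natCast]
    ring
  rw [h1, pderiv_C_mul, pderiv_mul, pderiv_pow, pderiv_lam_d, pderiv_pow, pderiv_X_self]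
  simp only [C_mul, map_natCast, Nat.sub_sub]
  ring

theorem spec_key {n : ℕ} (ε : Fin n → ℝ) (hε : ∀ j, ε j = 1 ∨ ε j = -1)
    (d : Fin n) (u : ℂ) (ℓ : ℕ) (μ : ℂ) (hμ : μ = u - ((n : ℂ) - 1) / 2) :
    C (-4 * (ε d : ℂ) * ((ℓ : ℂ) - 1 + u)) * gfac ε d μ ℓ
      - ∑ j, C (ε j : ℂ) * pderiv j (pderiv j (juhlSymbol ε d μ ℓ)) = 0 := by
  rw [← Finset.add_sum_erase _ _ (Finset.mem_univ d), box_juhl ε hε, box_juhl_d, gfac]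
  have h1 : (∑ k ∈ Finset.range (ℓ / 2 + 1),
        C (akCoeff μ ℓ k * ((ℓ - 2 * k : ℕ) * (ℓ - 2 * k - 1 : ℕ))) * lam ε d ^ k *
          X d ^ (ℓ - 2 * k - 2))
      = ∑ k ∈ Finset.range (ℓ / 2 + 1),
        C (- 4 * (k : ℂ) * (μ + ℓ - k) * akCoeff μ ℓ k) * lam ε d ^ (k - 1) *
          X d ^ (ℓ - 2 * k) := by
    rw [Finset.sum_range_succ, Finset.sum_range_succ']
    have hz : ((ℓ - 2 * (ℓ / 2) : ℕ) : ℂ) * ((ℓ - 2 * (ℓ / 2) - 1 : ℕ) : ℂ) = 0 := by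
      rcases Nat.mod_two_eq_zero_or_one ℓ with h | h
      · rw [show ℓ - 2 * (ℓ / 2) = 0 by omega]; simp
      · rw [show ℓ - 2 * (ℓ / 2) - 1 = 0 by omega]; simp
    rw [hz]
    simp only [mul_zero, C_0, zero_mul, Nat.cast_zero, add_zero]
    apply Finset.sum_congr rfl
    intro k hk
    have hk' := Finset.mem_range.1 hk
    have := akCoeff_rec μ ℓ k (by omega)
    rw [show ℓ - 2 * k - 2 = ℓ - 2 * (k + 1) by omega, show k + 1 - 1 = k by omega]
    congr 3
    push_cast
    linear_combination this
  rw [h1, Finset.mul_sum, Finset.mul_sum, Finset.mul_sum, ← Finset.sum_add_distrib,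
    ← Finset.sum_sub_distrib]
  apply Finset.sum_eq_zero
  intro k _
  have : (C (-4 * (ε d : ℂ) * ((ℓ : ℂ) - 1 + u)) * C (akCoeff μ ℓ k * k)
    - (C (ε d : ℂ) * C (- 4 * (k : ℂ) * (μ + ℓ - k) * akCoeff μ ℓ k)
      + C (-2 * (ε d : ℂ)) * C (akCoeff μ ℓ k * k * (2 * k + n - 3))) : MvPolynomial (Fin n) ℂ) = 0 := by
    simp only [← C_mul, ← C_add, ← C_sub]
    rw [← C_0]
    congr 1
    rw [hμ]
    ring
  linear_combination (lam ε d ^ (k - 1) * X d ^ (ℓ - 2 * k)) * this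

theorem juhl_cov {n : ℕ} (ε : Fin n → ℝ) (hε : ∀ j, ε j = 1 ∨ ε j = -1)
    (d : Fin n) (u : ℂ) (ℓ : ℕ) :
    CovFun ε d u ℓ (FlL n (juhlSymbol ε d (u - ((n : ℂ) - 1) / 2) ℓ)) := by
  have he : ∀ i, (ε i : ℂ) * ε i = 1 := by
    intro i; rcases hε i with h2 | h2 <;> rw [h2] <;> norm_num
  set μ := u - ((n : ℂ) - 1) / 2 with hμ
  have eulF : ∀ P f : MvPolynomial (Fin n) ℂ, FlL n P (∑ j, X j * pderiv j f)
      = FlL n (∑ j, X j * pderiv j P) f := by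
    intro P f
    simp only [map_sum, LinearMap.sum_apply, FlL_X_mul, FlL_pderiv]
  constructor
  · intro f
    rw [eulF, (juhl_hom ε d μ ℓ).sum_X_mul_pderiv, ← Nat.cast_smul_eq_nsmul ℂ, map_smul]
    rfl
  · intro i j hi hj hij f
    rw [map_sub, map_smul, map_smul, FlL_X_mul, FlL_X_mul, FlL_pderiv, FlL_pderiv, pderiv_juhl _ _ _ _ _ hi, pderiv_juhl _ _ _ _ _ hj]
    have hc : ∀ j, (C (ε j : ℂ) : MvPolynomial (Fin n) ℂ) * C (ε j : ℂ) = 1 := by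
      intro j; rw [← C_mul, he, C_1]
    have : (ε i : ℂ) • (X j * (C (-2 * (ε d : ℂ) * ε i) * (X i * gfac ε d μ ℓ)))
      - (ε j : ℂ) • (X i * (C (-2 * (ε d : ℂ) * ε j) * (X j * gfac ε d μ ℓ))) = 0 := by
      rw [smul_eq_C_mul, smul_eq_C_mul, C_mul (a := -2 * (ε d : ℂ)) (a' := (ε i : ℂ)),
        C_mul (a := -2 * (ε d : ℂ)) (a' := (ε j : ℂ))]
      linear_combination (X i * X j * C (-2 * (ε d : ℂ)) * gfac ε d μ ℓ) * (hc i - hc j)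
    have key := congrArg (fun P => FlL n P f) this
    simpa only [map_sub, map_smul, LinearMap.sub_apply, LinearMap.smul_apply, map_zero,
      LinearMap.zero_apply] using key
  · intro i hi f
    have hdeg : ∑ j, X j * pderiv j (pderiv i (juhlSymbol ε d μ ℓ))
        = C ((ℓ : ℂ) - 1) * pderiv i (juhlSymbol ε d μ ℓ) := by
      rcases Nat.eq_zero_or_pos ℓ with h | h
      · have : pderiv i (juhlSymbol ε d μ ℓ) = 0 := by
          rw [pderiv_juhl _ _ _ _ _ hi, gfac, h]; simp
        simp [this]
      · rw [((juhl_hom ε d μ ℓ).pderiv (i := i)).sum_X_mul_pderiv, nsmul_eq_mul, Nat.cast_sub h]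
        simp
    have hS := spec_key ε hε d u ℓ μ hμ
    have h1 : FlL n (juhlSymbol ε d μ ℓ) (∑ j, (ε j : ℂ) • (X j * (X j * pderiv i f)))
      = FlL n (X i * ∑ j, C (ε j : ℂ) * pderiv j (pderiv j (juhlSymbol ε d μ ℓ))) f := by
      rw [Finset.mul_sum]
      simp only [map_sum, LinearMap.sum_apply, map_smul, FlL_X_mul, FlL_pderiv, C_mul_smul,
        mul_smul_comm, LinearMap.smul_apply]
    rw [map_add, map_sub, h1, map_smul, map_smul, FlL_X_mul, FlL_X_mul, eulF, hdeg, pderiv_juhl _ _ _ _ _ hi]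
    have hc : (C (ε i : ℂ) : MvPolynomial (Fin n) ℂ) * C (ε i : ℂ) = 1 := by
      rw [← C_mul, he, C_1]
    have this : (2 * ε i : ℂ) • (C ((ℓ : ℂ) - 1) * (C (-2 * (ε d : ℂ) * ε i) * (X i * gfac ε d μ ℓ)))
        - X i * (∑ j, C (ε j : ℂ) * pderiv j (pderiv j (juhlSymbol ε d μ ℓ)))
        + (2 * u * ε i) • (C (-2 * (ε d : ℂ) * ε i) * (X i * gfac ε d μ ℓ)) = 0 := by
      simp only [smul_eq_C_mul, C_mul, C_add, C_sub, C_neg] at hS ⊢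
      rw [show (C 2 : MvPolynomial (Fin n) ℂ) = 2 from map_ofNat C 2] at *
      rw [show (C 4 : MvPolynomial (Fin n) ℂ) = 4 from map_ofNat C 4] at hS
      linear_combination X i * hS + (-4 * X i * gfac ε d μ ℓ * C (ε d : ℂ) * (C (ℓ : ℂ) - C 1 + C u)) * hc
    have key := congrArg (fun P => FlL n P f) this
    simpa only [map_sub, map_add, map_smul, LinearMap.sub_apply, LinearMap.add_apply,
      LinearMap.smul_apply, map_zero, LinearMap.zero_apply] using key

theorem juhl_ne {n : ℕ} (ε : Fin n → ℝ) (hε : ∀ j, ε j = 1 ∨ ε j = -1)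
    (d i : Fin n) (hi : i ≠ d) (μ : ℂ) (ℓ : ℕ) : juhlSymbol ε d μ ℓ ≠ 0 := by
  have he : ∀ i, (ε i : ℂ) * ε i = 1 := by
    intro i; rcases hε i with h2 | h2 <;> rw [h2] <;> norm_num
  intro h0
  obtain ⟨s, hs⟩ : ∃ s : ℂ, s ^ 2 = -(ε d : ℂ) * ε i :=
    IsAlgClosed.exists_pow_nat_eq _ (by norm_num)
  let φ : Fin n → Polynomial ℂ := fun j => if j = d then Polynomial.X else
    if j = i then Polynomial.C s else 0
  have hlam : aeval φ (lam ε d) = 1 := by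
    rw [lam, map_mul, map_sum, Finset.sum_eq_single i]
    · simp only [map_mul, map_pow, aeval_X, aeval_C, φ, if_neg hi, if_true, ← Polynomial.C_pow, hs]
      rw [← Polynomial.C_eq_algebraMap, ← Polynomial.C_eq_algebraMap,
        ← Polynomial.C_mul, ← Polynomial.C_mul, ← Polynomial.C_1]
      have hfin : -(ε d : ℂ) * ((ε i : ℂ) * (-(ε d : ℂ) * ε i)) = 1 := by
        linear_combination ((ε d : ℂ) * (ε d : ℂ)) * he i + he d
      rw [← Polynomial.C_mul, hfin]
    · intro b hb hbi
      simp [φ, Finset.ne_of_mem_erase hb, hbi]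
    · intro h; exact absurd (by simp [hi]) h
  have h1 := congrArg (aeval φ) h0
  rw [juhlSymbol_eq, map_sum, map_zero] at h1
  simp only [map_mul, map_pow, hlam, one_pow, mul_one, aeval_X, aeval_C] at h1
  have h2 := congrArg (fun p => Polynomial.coeff p (ℓ - 2 * (ℓ / 2))) h1
  simp only [Polynomial.finsetSum_coeff, φ, if_true, ← Polynomial.C_eq_algebraMap,
    Polynomial.coeff_C_mul, Polynomial.coeff_X_pow, Polynomial.coeff_zero] at h2
  rw [Finset.sum_eq_single (ℓ / 2)] at h2
  · rw [if_pos rfl, mul_one, akCoeff, show ℓ - ℓ / 2 = (ℓ + 1) / 2 by omega] at h2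
    simp [Nat.factorial_ne_zero] at h2
  · intro b hb hb2
    have := Finset.mem_range.1 hb
    rw [if_neg (by omega), mul_zero]
  · intro h; exact absurd (by simp) h


/-! ### partial derivatives of smooth functions on an open set -/

section smooth
variable {n : ℕ} {V : Set (Fin n → ℝ)}

theorem pd_congr (hV : IsOpen V) {f g : (Fin n → ℝ) → ℂ} (h : Set.EqOn f g V) (j : Fin n) :
    Set.EqOn (pd j f) (pd j g) V := by
  intro x hx
  have : f =ᶠ[nhds x] g := Filter.eventuallyEq_of_mem (hV.mem_nhds hx) h
  simp only [pd, this.fderiv_eq]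

theorem pd_smooth (hV : IsOpen V) {f : (Fin n → ℝ) → ℂ} (hf : ContDiffOn ℝ (⊤ : ℕ∞) f V)
    (j : Fin n) : ContDiffOn ℝ (⊤ : ℕ∞) (pd j f) V :=
  (hf.fderiv_of_isOpen hV (by norm_cast)).clm_apply contDiffOn_const

theorem pd_comm (hV : IsOpen V) {f : (Fin n → ℝ) → ℂ} (hf : ContDiffOn ℝ (⊤ : ℕ∞) f V)
    (i j : Fin n) : Set.EqOn (pd i (pd j f)) (pd j (pd i f)) V := by
  intro x hx
  have hfx : ContDiffAt ℝ (⊤ : ℕ∞) f x := hf.contDiffAt (hV.mem_nhds hx)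
  have hs := hfx.isSymmSndFDerivAt (by simp; norm_cast)
  have hd : DifferentiableAt ℝ (fderiv ℝ f) x :=
    ((hf.fderiv_of_isOpen hV (m := (⊤ : ℕ∞)) (by norm_cast)).contDiffAt (hV.mem_nhds hx)).differentiableAt
      (by simp)
  have h1 : ∀ k l : Fin n, pd k (pd l f) x
      = fderiv ℝ (fderiv ℝ f) x (Pi.single k 1) (Pi.single l 1) := by
    intro k l
    change fderiv ℝ (fun y => fderiv ℝ f y (Pi.single l 1)) x (Pi.single k 1) = _
    rw [fderiv_clm_apply hd (differentiableAt_const _)]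
    simp
  rw [h1, h1]; exact hs _ _

theorem pdi_congr (hV : IsOpen V) {f g : (Fin n → ℝ) → ℂ} (h : Set.EqOn f g V) (j : Fin n) (k : ℕ) :
    Set.EqOn ((pd j)^[k] f) ((pd j)^[k] g) V := by
  induction k generalizing f g with
  | zero => exact h
  | succ k ih => exact ih (pd_congr hV h j)

theorem pdi_smooth (hV : IsOpen V) {f : (Fin n → ℝ) → ℂ} (hf : ContDiffOn ℝ (⊤ : ℕ∞) f V)
    (j : Fin n) (k : ℕ) : ContDiffOn ℝ (⊤ : ℕ∞) ((pd j)^[k] f) V := by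
  induction k generalizing f with
  | zero => exact hf
  | succ k ih => exact ih (pd_smooth hV hf j)

theorem pdi_comm (hV : IsOpen V) {f : (Fin n → ℝ) → ℂ} (hf : ContDiffOn ℝ (⊤ : ℕ∞) f V)
    (i j : Fin n) (k : ℕ) : Set.EqOn (pd i ((pd j)^[k] f)) ((pd j)^[k] (pd i f)) V := by
  induction k generalizing f with
  | zero => exact fun x _ => rfl
  | succ k ih => 
    exact (ih (pd_smooth hV hf j)).trans (pdi_congr hV (pd_comm hV hf i j) j k)

/-- monoDiff along a list -/
def mdl (l : List (Fin n)) (m : Fin n → ℕ) (f : (Fin n → ℝ) → ℂ) : (Fin n → ℝ) → ℂ :=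
  l.foldr (fun j g => (pd j)^[m j] g) f

theorem mdl_smooth (hV : IsOpen V) {f : (Fin n → ℝ) → ℂ} (hf : ContDiffOn ℝ (⊤ : ℕ∞) f V)
    (l : List (Fin n)) (m : Fin n → ℕ) : ContDiffOn ℝ (⊤ : ℕ∞) (mdl l m f) V := by
  induction l with
  | nil => exact hf
  | cons a l ih => exact pdi_smooth hV ih a _

theorem mdl_comm (hV : IsOpen V) {f : (Fin n → ℝ) → ℂ} (hf : ContDiffOn ℝ (⊤ : ℕ∞) f V)
    (i : Fin n) (l : List (Fin n)) (m : Fin n → ℕ) :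
    Set.EqOn (pd i (mdl l m f)) (mdl l m (pd i f)) V := by
  induction l with
  | nil => exact fun x _ => rfl
  | cons a l ih =>
    exact (pdi_comm hV (mdl_smooth hV hf l m) i a (m a)).trans (pdi_congr hV ih a _)

theorem mdl_succ_notMem (f : (Fin n → ℝ) → ℂ)
    (i : Fin n) (l : List (Fin n)) (hl : i ∉ l) (m : Fin n →₀ ℕ) :
    mdl l (fun j => (m + Finsupp.single i 1 : Fin n →₀ ℕ) j) f = mdl l (fun j => m j) f := by
  induction l with
  | nil => rfl
  | cons a l ih =>
    simp only [List.mem_cons, not_or] at hl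
    simp only [mdl, List.foldr_cons] at ih ⊢
    rw [ih hl.2]
    simp [hl.1]

theorem mdl_succ (hV : IsOpen V) {f : (Fin n → ℝ) → ℂ} (hf : ContDiffOn ℝ (⊤ : ℕ∞) f V)
    (i : Fin n) (l : List (Fin n)) (hl : l.Nodup) (hi : i ∈ l) (m : Fin n →₀ ℕ) :
    Set.EqOn (mdl l (fun j => (m + Finsupp.single i 1 : Fin n →₀ ℕ) j) f)
      (mdl l (fun j => m j) (pd i f)) V := by
  induction l with
  | nil => simp at hi
  | cons a l ih =>
    rw [List.nodup_cons] at hl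
    by_cases hia : i = a
    · subst hia
      change Set.EqOn ((pd i)^[(m + Finsupp.single i 1 : Fin n →₀ ℕ) i] (mdl l _ f)) 
        ((pd i)^[m i] (mdl l _ (pd i f))) V
      rw [mdl_succ_notMem f i l hl.1 m]
      simp only [Finsupp.add_apply, Finsupp.single_eq_same, Function.iterate_succ_apply]
      exact pdi_congr hV (mdl_comm hV hf i l _) i _
    · have hi' : i ∈ l := by simpa [hia] using hi
      change Set.EqOn ((pd a)^[(m + Finsupp.single i 1 : Fin n →₀ ℕ) a] (mdl l _ f)) 
        ((pd a)^[m a] (mdl l _ (pd i f))) V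
      have : (m + Finsupp.single i 1 : Fin n →₀ ℕ) a = m a := by simp [hia]
      rw [this]
      exact pdi_congr hV (ih hl.2 hi') a _

theorem monoDiff_smooth (hV : IsOpen V) {f : (Fin n → ℝ) → ℂ} (hf : ContDiffOn ℝ (⊤ : ℕ∞) f V)
    (m : Fin n → ℕ) : ContDiffOn ℝ (⊤ : ℕ∞) (monoDiff m f) V := mdl_smooth hV hf _ m

theorem monoDiff_comm (hV : IsOpen V) {f : (Fin n → ℝ) → ℂ} (hf : ContDiffOn ℝ (⊤ : ℕ∞) f V)
    (i : Fin n) (m : Fin n → ℕ) :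
    Set.EqOn (pd i (monoDiff m f)) (monoDiff m (pd i f)) V := mdl_comm hV hf i _ m

theorem monoDiff_succ (hV : IsOpen V) {f : (Fin n → ℝ) → ℂ} (hf : ContDiffOn ℝ (⊤ : ℕ∞) f V)
    (i : Fin n) (m : Fin n →₀ ℕ) :
    Set.EqOn (monoDiff (fun j => (m + Finsupp.single i 1 : Fin n →₀ ℕ) j) f)
      (pd i (monoDiff (fun j => m j) f)) V :=
  (mdl_succ hV hf i _ (List.nodup_finRange n) (List.mem_finRange i) m).trans
    (monoDiff_comm hV hf i _).symm

theorem polyDiff_sum_of_subset (P : MvPolynomial (Fin n) ℂ) (f : (Fin n → ℝ) → ℂ)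
    (s : Finset (Fin n →₀ ℕ)) (hs : P.support ⊆ s) (x : Fin n → ℝ) :
    polyDiff P f x = ∑ m ∈ s, P.coeff m * monoDiff (fun j => m j) f x := by
  rw [polyDiff]
  apply Finset.sum_subset hs
  intro m _ hm
  rw [notMem_support_iff.1 hm, zero_mul]

theorem polyDiff_add (P Q : MvPolynomial (Fin n) ℂ) (f : (Fin n → ℝ) → ℂ) (x : Fin n → ℝ) :
    polyDiff (P + Q) f x = polyDiff P f x + polyDiff Q f x := by
  rw [polyDiff_sum_of_subset (P + Q) f (P.support ∪ Q.support) support_add,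
    polyDiff_sum_of_subset P f (P.support ∪ Q.support) Finset.subset_union_left,
    polyDiff_sum_of_subset Q f (P.support ∪ Q.support) Finset.subset_union_right,
    ← Finset.sum_add_distrib]
  apply Finset.sum_congr rfl
  intro m _
  rw [coeff_add, add_mul]

theorem polyDiff_C_mul (c : ℂ) (P : MvPolynomial (Fin n) ℂ) (f : (Fin n → ℝ) → ℂ) (x : Fin n → ℝ) :
    polyDiff (C c * P) f x = c * polyDiff P f x := by
  rw [polyDiff_sum_of_subset (C c * P) f P.support (by rw [C_mul']; exact support_smul),
    polyDiff, Finset.mul_sum]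
  apply Finset.sum_congr rfl
  intro m _
  rw [coeff_C_mul, mul_assoc]

theorem polyDiff_zero (f : (Fin n → ℝ) → ℂ) (x : Fin n → ℝ) :
    polyDiff (0 : MvPolynomial (Fin n) ℂ) f x = 0 := by simp [polyDiff]

theorem polyDiff_sum {ι : Type} (s : Finset ι) (P : ι → MvPolynomial (Fin n) ℂ)
    (f : (Fin n → ℝ) → ℂ) (x : Fin n → ℝ) :
    polyDiff (∑ i ∈ s, P i) f x = ∑ i ∈ s, polyDiff (P i) f x := by
  classical
  induction s using Finset.induction_on with
  | empty => simp [polyDiff_zero]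
  | insert a s ha ih => rw [Finset.sum_insert ha, Finset.sum_insert ha, polyDiff_add, ih]

theorem polyDiff_monomial (m : Fin n →₀ ℕ) (c : ℂ)
    (f : (Fin n → ℝ) → ℂ) (x : Fin n → ℝ) :
    polyDiff (monomial m c) f x = c * monoDiff (fun j => m j) f x := by
  rw [polyDiff_sum_of_subset _ f {m} support_monomial_subset]
  simp

theorem polyDiff_X_mul (hV : IsOpen V) {f : (Fin n → ℝ) → ℂ} (hf : ContDiffOn ℝ (⊤ : ℕ∞) f V)
    (i : Fin n) (P : MvPolynomial (Fin n) ℂ) :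
    Set.EqOn (polyDiff (X i * P) f) (pd i (polyDiff P f)) V := by
  intro x hx
  have h1 : pd i (polyDiff P f) x = ∑ m ∈ P.support, P.coeff m * pd i (monoDiff (fun j => m j) f) x := by
    have hd : ∀ m ∈ P.support, DifferentiableAt ℝ (fun y => P.coeff m * monoDiff (fun j => m j) f y) x := by
      intro m _
      apply DifferentiableAt.const_mul
      exact ((monoDiff_smooth hV hf _).contDiffAt (hV.mem_nhds hx)).differentiableAt (by simp)
    unfold pd polyDiff
    rw [fderiv_fun_sum hd, sum_apply]
    apply Finset.sum_congr rfl
    intro m _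
    rw [fderiv_const_mul]
    · simp
    · exact ((monoDiff_smooth hV hf _).contDiffAt (hV.mem_nhds hx)).differentiableAt (by simp)
  rw [h1]
  conv_lhs => rw [P.as_sum, Finset.mul_sum, polyDiff_sum]
  apply Finset.sum_congr rfl
  intro m _
  rw [X_mul_mon, polyDiff_monomial, monoDiff_succ hV hf i m hx]

theorem juhlOp_eq (hV : IsOpen V) {f : (Fin n → ℝ) → ℂ} (hf : ContDiffOn ℝ (⊤ : ℕ∞) f V)
    (ε : Fin n → ℝ) (d : Fin n) (μ : ℂ) (ℓ : ℕ) :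
    Set.EqOn (juhlOp ε d μ ℓ f) (polyDiff (juhlSymbol ε d μ ℓ) f) V := by
  have h0 : polyDiff (1 : MvPolynomial (Fin n) ℂ) f = f := by
    funext x
    have : (1 : MvPolynomial (Fin n) ℂ) = monomial 0 1 := rfl
    rw [this, polyDiff_monomial, one_mul]
    have : ∀ l : List (Fin n), mdl l (fun j => (0 : Fin n →₀ ℕ) j) f = f := by
      intro l
      induction l with
      | nil => rfl
      | cons a l ih => simpa [mdl] using ih
    exact congrFun (this _) x
  have h1 : ∀ r, Set.EqOn ((pd d)^[r] f) (polyDiff (X d ^ r) f) V := by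
    intro r
    induction r with
    | zero => intro x _; simp [h0]
    | succ r ih =>
      rw [Function.iterate_succ_apply', pow_succ']
      exact (pd_congr hV ih d).trans (polyDiff_X_mul hV hf d _).symm
  have h2 : ∀ (P : MvPolynomial (Fin n) ℂ) (g : (Fin n → ℝ) → ℂ), Set.EqOn g (polyDiff P f) V →
      Set.EqOn (sLap ε d g) (polyDiff (lam ε d * P) f) V := by
    intro P g hg x hx
    rw [sLap, lam, mul_assoc, polyDiff_C_mul, Finset.sum_mul, polyDiff_sum]
    congr 1
    apply Finset.sum_congr rfl
    intro j _
    rw [mul_assoc, polyDiff_C_mul, pow_two, mul_assoc, polyDiff_X_mul hV hf j _ hx]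
    congr 1
    exact pd_congr hV ((pd_congr hV hg j).trans (polyDiff_X_mul hV hf j _).symm) j hx
  have h3 : ∀ k r, Set.EqOn ((sLap ε d)^[k] ((pd d)^[r] f)) (polyDiff (lam ε d ^ k * X d ^ r) f) V := by
    intro k r
    induction k with
    | zero => simpa using h1 r
    | succ k ih =>
      rw [Function.iterate_succ_apply', pow_succ', mul_assoc]
      exact h2 _ _ ih
  intro x hx
  rw [juhlSymbol_eq, polyDiff_sum, juhlOp]
  apply Finset.sum_congr rfl
  intro k _
  rw [mul_assoc, polyDiff_C_mul, h3 k _ hx]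

end smooth

/-! ### polynomial test functions -/

section pf
variable {n : ℕ} {𝕜 : Type} [RCLike 𝕜]

def pf (x0 : Fin n → ℝ) (f : MvPolynomial (Fin n) 𝕜) : (Fin n → ℝ) → 𝕜 :=
  fun y => eval (fun j => ((y j - x0 j : ℝ) : 𝕜)) f

theorem coord_contDiff (x0 : Fin n → ℝ) (i : Fin n) :
    ContDiff ℝ (⊤ : ℕ∞) (fun y : Fin n → ℝ => ((y i - x0 i : ℝ) : 𝕜)) := by
  have : ContDiff ℝ (⊤ : ℕ∞) (fun y : Fin n → ℝ => RCLike.ofRealCLM (K := 𝕜) (y i - x0 i)) :=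
    (RCLike.ofRealCLM (K := 𝕜)).contDiff.comp ((contDiff_apply ℝ ℝ i).sub contDiff_const)
  exact this

theorem pf_contDiff (x0 : Fin n → ℝ) (f : MvPolynomial (Fin n) 𝕜) :
    ContDiff ℝ (⊤ : ℕ∞) (pf x0 f) := by
  induction f using MvPolynomial.induction_on with
  | C a =>
    have : pf x0 (C a) = fun _ => a := by funext y; simp [pf]
    rw [this]; exact contDiff_const
  | add p q hp hq => 
    have : pf x0 (p + q) = fun y => pf x0 p y + pf x0 q y := by funext y; simp [pf]
    rw [this]; exact hp.add hq
  | mul_X p i hp =>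
    have : pf x0 (p * X i) = fun y => pf x0 p y * ((y i - x0 i : ℝ) : 𝕜) := by
      funext y; simp [pf]
    rw [this]; exact hp.mul (coord_contDiff x0 i)

theorem pd_coord (x0 : Fin n → ℝ) (i j : Fin n) (y : Fin n → ℝ) :
    fderiv ℝ (fun y : Fin n → ℝ => ((y i - x0 i : ℝ) : 𝕜)) y (Pi.single j 1)
      = if i = j then 1 else 0 := by
  have h : HasFDerivAt (fun y : Fin n → ℝ => RCLike.ofRealCLM (K := 𝕜) (y i - x0 i))
      ((RCLike.ofRealCLM (K := 𝕜)).comp (ContinuousLinearMap.proj (R := ℝ) (φ := fun _ : Fin n => ℝ) i)) y :=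
    (RCLike.ofRealCLM (K := 𝕜)).hasFDerivAt.comp y ((hasFDerivAt_apply i y).sub_const _)
  have h' : fderiv ℝ (fun y : Fin n → ℝ => ((y i - x0 i : ℝ) : 𝕜)) y = _ := h.fderiv
  rw [h']
  simp [Pi.single_apply]

theorem pd_pf (x0 : Fin n → ℝ) (f : MvPolynomial (Fin n) 𝕜) (j : Fin n) :
    pd j (pf x0 f) = pf x0 (pderiv j f) := by
  have hdiff : ∀ f : MvPolynomial (Fin n) 𝕜, Differentiable ℝ (pf x0 f) := fun f =>
    (pf_contDiff x0 f).differentiable (by simp)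
  induction f using MvPolynomial.induction_on with
  | C a => 
    have : pf x0 (C a) = fun _ => a := by funext y; simp [pf]
    funext y
    simp [pd, this, pf]
  | add p q hp hq => 
    have : pf x0 (p + q) = fun y => pf x0 p y + pf x0 q y := by funext y; simp [pf]
    funext y
    have hp' := congrFun hp y
    have hq' := congrFun hq y
    simp only [pd] at hp' hq' ⊢
    rw [this, fderiv_fun_add (hdiff p y) (hdiff q y), add_apply, hp', hq']
    simp [pf]
  | mul_X p i hp =>
    have : pf x0 (p * X i) = fun y => pf x0 p y * ((y i - x0 i : ℝ) : 𝕜) := by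
      funext y; simp [pf]
    funext y
    have hp' := congrFun hp y
    simp only [pd] at hp' ⊢
    rw [this, fderiv_fun_mul (hdiff p y) (((coord_contDiff x0 i).differentiable (by simp)) y)]
    simp only [add_apply, smul_apply, hp', pd_coord]
    simp only [pf, pderiv_mul, map_add, map_mul, eval_X, pderiv_X, Pi.single_apply, smul_eq_mul]
    by_cases h : i = j
    · subst h; simp; ring
    · simp [h]; ring

/-- algebraic iterated derivative along a list -/
def amd (l : List (Fin n)) (m : Fin n → ℕ) (f : MvPolynomial (Fin n) ℂ) : MvPolynomial (Fin n) ℂ :=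
  l.foldr (fun j g => (fun p => pderiv j p)^[m j] g) f

theorem pdi_pf (x0 : Fin n → ℝ) (f : MvPolynomial (Fin n) ℂ) (j : Fin n) (k : ℕ) :
    (pd j)^[k] (pf x0 f) = pf x0 ((fun p => pderiv j p)^[k] f) := by
  induction k generalizing f with
  | zero => rfl
  | succ k ih => rw [Function.iterate_succ_apply, pd_pf, ih, Function.iterate_succ_apply]

theorem mdl_pf (x0 : Fin n → ℝ) (f : MvPolynomial (Fin n) ℂ) (l : List (Fin n)) (m : Fin n → ℕ) :
    mdl l m (pf x0 f) = pf x0 (amd l m f) := by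
  induction l with
  | nil => rfl
  | cons a l ih =>
    change (pd a)^[m a] (mdl l m (pf x0 f)) = _
    rw [ih, pdi_pf]; rfl

theorem coeff_pdi (j : Fin n) (r : ℕ) (f : MvPolynomial (Fin n) ℂ) (k : Fin n →₀ ℕ) (hk : k j = 0) :
    coeff k ((fun p => pderiv j p)^[r] f) = r.factorial * coeff (k + Finsupp.single j r) f := by
  induction r generalizing f with
  | zero => simp
  | succ r ih =>
    rw [Function.iterate_succ_apply, ih, coeff_pderiv, Nat.factorial_succ, add_assoc,
      ← Finsupp.single_add]
    simp [hk]; ring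

theorem coeff_amd (l : List (Fin n)) (hl : l.Nodup) (m : Fin n → ℕ) (f : MvPolynomial (Fin n) ℂ)
    (k : Fin n →₀ ℕ) (hk : ∀ j ∈ l, k j = 0) :
    coeff k (amd l m f) = (l.map (fun j => ((m j).factorial : ℂ))).prod
      * coeff (k + (l.map (fun j => Finsupp.single j (m j))).sum) f := by
  induction l generalizing k with
  | nil => simp [amd]
  | cons a l ih =>
    rw [List.nodup_cons] at hl
    change coeff k ((fun p => pderiv a p)^[m a] (amd l m f)) = _
    rw [coeff_pdi _ _ _ _ (hk a (by simp)), ih hl.2]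
    · simp [add_assoc, mul_assoc]
    · intro j hj
      have : a ≠ j := by rintro rfl; exact hl.1 hj
      simp [hk j (by simp [hj]), this]

theorem monoDiff_pf (x0 : Fin n → ℝ) (f : MvPolynomial (Fin n) ℂ) (m : Fin n →₀ ℕ) :
    monoDiff (fun j => m j) (pf x0 f) x0 = (∏ j, ((m j).factorial : ℂ)) * coeff m f := by
  have h : monoDiff (fun j => m j) (pf x0 f) = _ := mdl_pf x0 f (List.finRange n) _
  rw [h]
  have h2 : ∀ p : MvPolynomial (Fin n) ℂ, pf x0 p x0 = coeff 0 p := by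
    intro p
    simp only [pf, sub_self]
    rw [← constantCoeff_eq, constantCoeff_eq]
    have : (fun j : Fin n => (((0:ℝ)) : ℂ)) = 0 := by funext j; simp
    change eval (fun j : Fin n => (((0:ℝ)) : ℂ)) p = _
    rw [this, eval_zero, constantCoeff_eq]
  rw [h2, coeff_amd _ (List.nodup_finRange n) _ _ _ (by simp)]
  rw [← List.ofFn_eq_map, ← List.ofFn_eq_map, List.prod_ofFn, List.sum_ofFn, zero_add,
    Finsupp.univ_sum_single m]

theorem polyDiff_pf (x0 : Fin n → ℝ) (P f : MvPolynomial (Fin n) ℂ) :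
    polyDiff P (pf x0 f) x0 = FlL n P f := by
  rw [FlL_apply, polyDiff]
  simp only [monoDiff_pf]

end pf


section kill
variable {n : ℕ}

theorem pf_cast (x0 : Fin n → ℝ) (p : MvPolynomial (Fin n) ℝ) (y : Fin n → ℝ) :
    ((pf x0 p y : ℝ) : ℂ) = pf x0 (map Complex.ofRealHom p) y := by
  induction p using MvPolynomial.induction_on with
  | C a => simp [pf]
  | add p q hp hq =>
    simp only [pf, map_add, Complex.ofReal_add] at hp hq ⊢
    rw [hp, hq]
  | mul_X p i hp =>
    simp only [pf, map_mul, Complex.ofReal_mul, eval_X, map_X] at hp ⊢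
    rw [hp]; rfl

/-- polynomial conformal Killing pairs -/
def PolyKill (ε : Fin n → ℝ) (z : Fin n → MvPolynomial (Fin n) ℝ) (r : MvPolynomial (Fin n) ℝ) :
    Prop := ∀ i j, C (ε i) * pderiv j (z i) + C (ε j) * pderiv i (z j)
      = r * C (ε i) * (if i = j then 1 else 0)

theorem PolyKill.isKill {ε : Fin n → ℝ} {z : Fin n → MvPolynomial (Fin n) ℝ}
    {r : MvPolynomial (Fin n) ℝ} (h : PolyKill ε z r) (V : Set (Fin n → ℝ)) (x0 : Fin n → ℝ) :
    IsConformalKillingPair ε V (fun y j => pf x0 (z j) y) (pf x0 r) := by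
  refine ⟨?_, (pf_contDiff x0 r).contDiffOn, ?_⟩
  · exact (contDiff_pi.2 fun j => pf_contDiff x0 (z j)).contDiffOn
  · intro i j x _
    have h1 := congrArg (fun p => pf x0 p x) (h i j)
    have e1 : ∀ i, (fun y => pf x0 (z i) y) = pf x0 (z i) := fun i => rfl
    simp only [e1, pd_pf]
    simp only [pf, map_add, map_mul, eval_C] at h1 ⊢
    rw [h1]
    split_ifs <;> simp

theorem kill_trans (ε : Fin n → ℝ) (i : Fin n) :
    PolyKill ε (fun k => if k = i then 1 else 0) 0 := by
  intro a b
  have e1 : ∀ (P : Prop) [Decidable P] (b : Fin n),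
      pderiv b (if P then (1 : MvPolynomial (Fin n) ℝ) else 0) = 0 := by
    intro P _ b; split_ifs <;> simp
  simp only [e1]
  simp

theorem kill_eul (ε : Fin n → ℝ) : PolyKill ε (fun k => X k) (C 2) := by
  intro a b
  rw [show (C 2 : MvPolynomial (Fin n) ℝ) = 2 from map_ofNat C 2]
  by_cases h : a = b
  · subst h; simp; ring
  · simp [pderiv_X, h, Ne.symm h]

theorem kill_rot (ε : Fin n → ℝ) (i j : Fin n) :
    PolyKill ε (fun k => (if k = j then C (ε i) * X i else 0) - (if k = i then C (ε j) * X j else 0))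
      0 := by
  intro a b
  have e1 : ∀ (P : Prop) [Decidable P] (b : Fin n) (p : MvPolynomial (Fin n) ℝ),
      pderiv b (if P then p else 0) = if P then pderiv b p else 0 := by
    intro P _ b p; split_ifs <;> simp
  simp only [map_sub, e1, pderiv_C_mul, pderiv_X, Pi.single_apply]
  split_ifs <;> subst_vars <;> first | ring1 | simp_all

theorem kill_spec (ε : Fin n → ℝ) (i : Fin n) :
    PolyKill ε (fun k => C (2 * ε i) * (X i * X k) - (if k = i then ∑ l, C (ε l) * X l ^ 2 else 0))
      (C (4 * ε i) * X i) := by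
  have e1 : ∀ (P : Prop) [Decidable P] (b : Fin n) (p : MvPolynomial (Fin n) ℝ),
      pderiv b (if P then p else 0) = if P then pderiv b p else 0 := by
    intro P _ b p; split_ifs <;> simp
  have e2 : ∀ b : Fin n, pderiv b (∑ l, C (ε l) * X l ^ 2 : MvPolynomial (Fin n) ℝ)
      = C (2 * ε b) * X b := by
    intro b
    rw [map_sum, Finset.sum_eq_single b]
    · rw [pderiv_C_mul, pderiv_pow, pderiv_X_self, C_mul,
        show (C 2 : MvPolynomial (Fin n) ℝ) = 2 from map_ofNat C 2]
      push_cast; ring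
    · intro c _ hc
      simp [pderiv_X_of_ne hc]
    · simp
  intro a b
  have e3 : ∀ b k : Fin n, pderiv b (C (2 * ε i) * (X i * X k) : MvPolynomial (Fin n) ℝ)
      = C (2 * ε i) * ((if i = b then 1 else 0) * X k + X i * (if k = b then 1 else 0)) := by
    intro b k
    rw [pderiv_C_mul, pderiv_mul, pderiv_X, pderiv_X]
    simp only [Pi.single_apply, eq_comm]
  simp only [map_sub, e1, e2, e3]
  simp only [C_mul]
  rw [show (C 2 : MvPolynomial (Fin n) ℝ) = 2 from map_ofNat C 2,
    show (C 4 : MvPolynomial (Fin n) ℝ) = 4 from map_ofNat C 4]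
  by_cases h1 : a = i
  · subst h1
    by_cases h3 : a = b
    · subst h3; simp; ring
    · simp [h3, Ne.symm h3]; ring
  · by_cases h3 : a = b
    · subst h3; simp [h1, Ne.symm h1]; ring
    · by_cases h4 : b = i
      · subst h4; simp [h1, Ne.symm h1]; ring
      · simp [h1, Ne.symm h1, h3, Ne.symm h3, h4, Ne.symm h4]

end kill

section main
variable {n : ℕ} {ε : Fin n → ℝ} {d : Fin n} {u v : ℂ} {V : Set (Fin n → ℝ)}
  {D : ((Fin n → ℝ) → ℂ) → (Fin n → ℝ) → ℂ}

/-- The covariance hypothesis. -/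
def Cov (ε : Fin n → ℝ) (d : Fin n) (u v : ℂ) (V : Set (Fin n → ℝ))
    (D : ((Fin n → ℝ) → ℂ) → (Fin n → ℝ) → ℂ) : Prop :=
  ∀ (Z : (Fin n → ℝ) → (Fin n → ℝ)) (ρ : (Fin n → ℝ) → ℝ),
      IsConformalKillingPair ε V Z ρ →
      (∀ x ∈ V, x d = 0 → Z x d = 0) →
      ∀ f : (Fin n → ℝ) → ℂ, ContDiffOn ℝ (⊤ : ℕ∞) f V →
      ∀ x ∈ V, x d = 0 →
        D (fun y => (∑ j, (Z y j : ℂ) * pd j f y) + u / 2 * (ρ y : ℂ) * f y) x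
          = (∑ j ∈ Finset.univ.erase d,
              (Z x j : ℂ) * lineDeriv ℝ (D f) x (Pi.single j 1))
            + v / 2 * (ρ x : ℂ) * D f x

theorem pf_self {𝕜 : Type} [RCLike 𝕜] (x0 : Fin n → ℝ) (p : MvPolynomial (Fin n) 𝕜) :
    pf x0 p x0 = eval 0 p := by
  simp only [pf, sub_self]
  congr 2
  funext j; simp

theorem cov_poly (h : Cov ε d u v V D) {z : Fin n → MvPolynomial (Fin n) ℝ}
    {r : MvPolynomial (Fin n) ℝ} (hz : PolyKill ε z r)
    (ht : ∀ w : Fin n → ℝ, w d = 0 → eval w (z d) = 0)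
    (x0 : Fin n → ℝ) (hx : x0 ∈ V) (hx0 : x0 d = 0) (f : MvPolynomial (Fin n) ℂ) :
    D (pf x0 ((∑ j, map Complex.ofRealHom (z j) * pderiv j f)
        + C (u / 2) * map Complex.ofRealHom r * f)) x0
      = (∑ j ∈ Finset.univ.erase d,
          ((eval 0 (z j) : ℝ) : ℂ) * lineDeriv ℝ (D (pf x0 f)) x0 (Pi.single j 1))
        + v / 2 * ((eval 0 r : ℝ) : ℂ) * D (pf x0 f) x0 := by
  have := h _ _ (hz.isKill V x0) (by
    intro x _ hxd
    apply ht
    simp [hxd, hx0]) (pf x0 f) (pf_contDiff x0 f).contDiffOn x0 hx hx0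
  simp only [pf_self] at this
  rw [← this]
  congr 1
  funext y
  simp only [pd_pf, pf_cast]
  simp only [pf, map_add, map_sum, map_mul, eval_C]

end main

section const
variable {n : ℕ} {ε : Fin n → ℝ} {d : Fin n} {u v : ℂ} {V : Set (Fin n → ℝ)}
  {D : ((Fin n → ℝ) → ℂ) → (Fin n → ℝ) → ℂ} {N : ℕ} {a : (Fin n → ℕ) → (Fin n → ℝ) → ℂ}

theorem line_mem (hV : IsOpen V) {x0 : Fin n → ℝ} (hx : x0 ∈ V) (hx0 : x0 d = 0)
    {i : Fin n} (hi : i ≠ d) :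
    ∀ᶠ t : ℝ in nhds 0, x0 + t • (Pi.single i 1 : Fin n → ℝ) ∈ V ∩ {x | x d = 0} := by
  have hc : Continuous (fun t : ℝ => x0 + t • (Pi.single i 1 : Fin n → ℝ)) := by fun_prop
  have : (fun t : ℝ => x0 + t • (Pi.single i 1 : Fin n → ℝ)) ⁻¹' V ∈ nhds (0:ℝ) :=
    (hV.preimage hc).mem_nhds (by simpa using hx)
  filter_upwards [this] with t ht
  refine ⟨ht, ?_⟩
  simp [hx0, Pi.single_apply, hi.symm]

theorem line_diff (hV : IsOpen V) {x0 : Fin n → ℝ} (hx : x0 ∈ V) (hx0 : x0 d = 0)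
    {i : Fin n} (hi : i ≠ d) {b : (Fin n → ℝ) → ℂ}
    (hb : ContDiffOn ℝ (⊤ : ℕ∞) b (V ∩ {x | x d = 0})) :
    DifferentiableAt ℝ (fun t : ℝ => b (x0 + t • (Pi.single i 1 : Fin n → ℝ))) 0 := by
  have hev := line_mem (d := d) hV hx hx0 hi
  have hb' := hb.differentiableOn (by simp)
  have h0 : x0 + (0:ℝ) • (Pi.single i 1 : Fin n → ℝ) ∈ V ∩ {x | x d = 0} := by
    simpa using ⟨hx, hx0⟩
  have hc : DifferentiableOn ℝ (fun t : ℝ => x0 + t • (Pi.single i 1 : Fin n → ℝ))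
      ((fun t : ℝ => x0 + t • (Pi.single i 1 : Fin n → ℝ)) ⁻¹' (V ∩ {x | x d = 0})) := by
    fun_prop
  exact ((hb'.comp hc (fun t ht => ht)) 0 h0).differentiableAt hev

theorem coeff_lineDeriv (hV : IsOpen V) (ha : ∀ m ∈ multiIdx n N,
      ContDiffOn ℝ (⊤ : ℕ∞) (a m) (V ∩ {x | x d = 0}))
    (hD : ∀ f x, D f x = ∑ m ∈ multiIdx n N, a m x * monoDiff m f x)
    (h : Cov ε d u v V D) {x0 : Fin n → ℝ} (hx : x0 ∈ V) (hx0 : x0 d = 0)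
    {i : Fin n} (hi : i ≠ d) (m : Fin n → ℕ) (hm : m ∈ multiIdx n N) :
    lineDeriv ℝ (a m) x0 (Pi.single i 1) = 0 := by
  have key : ∀ f : MvPolynomial (Fin n) ℂ,
      ∑ m ∈ multiIdx n N, lineDeriv ℝ (a m) x0 (Pi.single i 1) * monoDiff m (pf x0 f) x0 = 0 := by
    intro f
    have h1 := cov_poly h (kill_trans ε i) (by intro w _; simp [hi.symm]) x0 hx hx0 f
    have e1 : ∑ j, map Complex.ofRealHom (if j = i then (1 : MvPolynomial (Fin n) ℝ) else 0)
        * pderiv j f + C (u / 2) * map Complex.ofRealHom 0 * f = pderiv i f := by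
      rw [Finset.sum_eq_single i]
      · simp
      · intro b _ hb; simp [hb]
      · simp
    rw [e1, Finset.sum_eq_single i] at h1
    rotate_left
    · intro b _ hb; simp [hb]
    · intro h'; exact absurd (by simp [hi]) h'
    have h2 : HasDerivAt (fun t : ℝ => D (pf x0 f) (x0 + t • (Pi.single i 1 : Fin n → ℝ)))
        (∑ m ∈ multiIdx n N, (lineDeriv ℝ (a m) x0 (Pi.single i 1) * monoDiff m (pf x0 f) x0
          + a m x0 * monoDiff m (pf x0 (pderiv i f)) x0)) 0 := by
      simp only [hD]
      apply HasDerivAt.fun_sum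
      intro m hm
      have h3 : HasDerivAt (fun t : ℝ => a m (x0 + t • (Pi.single i 1 : Fin n → ℝ)))
        (lineDeriv ℝ (a m) x0 (Pi.single i 1)) 0 := (line_diff hV hx hx0 hi (ha m hm)).hasDerivAt
      have h4 : HasDerivAt (fun t : ℝ => monoDiff m (pf x0 f) (x0 + t • (Pi.single i 1 : Fin n → ℝ)))
          (monoDiff m (pf x0 (pderiv i f)) x0) 0 := by
        have hs := monoDiff_smooth isOpen_univ (pf_contDiff x0 f).contDiffOn m
        have hd : DifferentiableAt ℝ (monoDiff m (pf x0 f)) x0 :=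
          (hs.contDiffAt Filter.univ_mem).differentiableAt (by simp)
        have h5 := hd.hasFDerivAt.hasLineDerivAt (Pi.single i 1)
        have h6 : fderiv ℝ (monoDiff m (pf x0 f)) x0 (Pi.single i 1)
            = monoDiff m (pf x0 (pderiv i f)) x0 := by
          have := monoDiff_comm isOpen_univ (pf_contDiff x0 f).contDiffOn i m (Set.mem_univ x0)
          rw [pd_pf] at this
          exact this
        rw [h6] at h5
        exact h5
      have := h3.fun_mul h4
      simp only [zero_smul, add_zero] at this
      exact this
    have h7 : lineDeriv ℝ (D (pf x0 f)) x0 (Pi.single i 1) = _ := h2.deriv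
    rw [h7, hD, Finset.sum_add_distrib] at h1
    simp at h1
    exact h1
  have h8 := key (monomial (Finsupp.equivFunOnFinite.symm m) 1)
  have h9 : ∀ m' : Fin n → ℕ, monoDiff m' (pf x0 (monomial (Finsupp.equivFunOnFinite.symm m) (1:ℂ))) x0
      = (∏ j, ((m' j).factorial : ℂ)) * (if m = m' then 1 else 0) := by
    intro m'
    have := monoDiff_pf x0 (monomial (Finsupp.equivFunOnFinite.symm m) (1:ℂ))
      (Finsupp.equivFunOnFinite.symm m')
    rw [coeff_monomial] at this
    simpa using this
  simp only [h9] at h8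
  rw [Finset.sum_eq_single m] at h8
  · simp only [if_true, mul_one] at h8
    rcases mul_eq_zero.1 h8 with h10 | h10
    · exact h10
    · exact absurd h10 (prodfac_ne (Finsupp.equivFunOnFinite.symm m))
  · intro b _ hb; simp [Ne.symm hb]
  · intro h'; exact absurd hm h'

theorem const_of_lineDeriv (hV : IsOpen V) (hconn : IsPreconnected (V ∩ {x | x d = 0}))
    {b : (Fin n → ℝ) → ℂ} (hb : ContDiffOn ℝ (⊤ : ℕ∞) b (V ∩ {x | x d = 0}))
    (h0 : ∀ x ∈ V, x d = 0 → ∀ i, i ≠ d → lineDeriv ℝ b x (Pi.single i 1) = 0)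
    {x y : Fin n → ℝ} (hx : x ∈ V ∩ {x | x d = 0}) (hy : y ∈ V ∩ {x | x d = 0}) : b x = b y := by
  refine hconn.induction₂ (fun x y => b x = b y) ?_ (fun _ _ _ _ _ _ h1 h2 => h1.trans h2)
    (fun _ _ _ _ h => h.symm) hx hy
  intro x hx
  let π : (Fin n → ℝ) → (Fin n → ℝ) := fun y => Function.update y d 0
  have hπ : ContDiff ℝ (⊤ : ℕ∞) π := by
    rw [contDiff_pi]
    intro i
    by_cases hi : i = d
    · subst hi; simpa [π] using contDiff_const
    · simpa [π, hi] using contDiff_apply ℝ ℝ i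
  have hfix : ∀ y, y d = 0 → π y = y := by
    intro y hy
    simp only [π]; rw [← hy]; exact Function.update_eq_self d y
  have hW : IsOpen (π ⁻¹' V) := hV.preimage hπ.continuous
  have hxW : x ∈ π ⁻¹' V := by
    change π x ∈ V; rw [hfix x hx.2]; exact hx.1
  obtain ⟨r, hr, hball⟩ := Metric.isOpen_iff.1 hW x hxW
  have hmem : ∀ y ∈ Metric.ball x r, π y ∈ V ∩ {x | x d = 0} := fun y hy =>
    ⟨hball hy, by simp [π]⟩
  have hdiff : DifferentiableOn ℝ (b ∘ π) (Metric.ball x r) :=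
    (hb.comp hπ.contDiffOn hmem).differentiableOn (by simp)
  have hzero : Set.EqOn (fderiv ℝ (b ∘ π)) 0 (Metric.ball x r) := by
    intro y hy
    have hdy := (hdiff y hy).differentiableAt (Metric.isOpen_ball.mem_nhds hy)
    have hb0 : ∀ i, fderiv ℝ (b ∘ π) y (Pi.single i 1) = 0 := by
      intro i
      rw [← hdy.lineDeriv_eq_fderiv]
      by_cases hi : i = d
      · subst hi
        have : ∀ t : ℝ, π (y + t • (Pi.single i 1 : Fin n → ℝ)) = π y := by
          intro t; funext k
          by_cases hk : k = i
          · subst hk; simp [π]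
          · simp [π, hk]
        simp [lineDeriv, this]
      · have : ∀ t : ℝ, π (y + t • (Pi.single i 1 : Fin n → ℝ))
            = π y + t • (Pi.single i 1 : Fin n → ℝ) := by
          intro t; funext k
          by_cases hk : k = d
          · subst hk; simp [π, Ne.symm hi, Pi.single_apply]
          · simp [π, hk]
        have h1 := h0 (π y) (hmem y hy).1 (hmem y hy).2 i hi
        simpa [lineDeriv, this] using h1
    change fderiv ℝ (b ∘ π) y = 0
    ext w
    rw [← Finset.univ_sum_single w, map_sum]
    apply Finset.sum_eq_zero
    intro i _
    have : (Pi.single i (w i) : Fin n → ℝ) = w i • Pi.single i 1 := by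
      rw [← Pi.single_smul]; simp
    rw [this, map_smul, hb0, smul_zero]
  rw [eventually_nhdsWithin_iff]
  filter_upwards [Metric.ball_mem_nhds x hr] with y hy hyH
  have := Metric.isOpen_ball.is_const_of_fderiv_eq_zero
    (convex_ball x r).isPreconnected hdiff hzero (Metric.mem_ball_self hr) hy
  simpa [hfix x hx.2, hfix y hyH.2] using this

end const

theorem main_gen {n : ℕ} (ε : Fin n → ℝ) (hε : ∀ j, ε j = 1 ∨ ε j = -1)
    (d i1 i2 : Fin n) (hi1 : i1 ≠ d) (hi2 : i2 ≠ d) (hi12 : i1 ≠ i2)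
    (u v : ℂ) (V : Set (Fin n → ℝ)) (hV : IsOpen V)
    (hconn : IsConnected (V ∩ {x | x d = 0}))
    (N : ℕ) (a : (Fin n → ℕ) → (Fin n → ℝ) → ℂ)
    (ha : ∀ m ∈ multiIdx n N, ContDiffOn ℝ (⊤ : ℕ∞) (a m) (V ∩ {x | x d = 0}))
    (D : ((Fin n → ℝ) → ℂ) → (Fin n → ℝ) → ℂ)
    (hD : ∀ f x, D f x = ∑ m ∈ multiIdx n N, a m x * monoDiff m f x)
    (h : Cov ε d u v V D) :
    (∀ f : (Fin n → ℝ) → ℂ, ContDiffOn ℝ (⊤ : ℕ∞) f V →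
        ∀ x ∈ V, x d = 0 → D f x = 0) ∨
    (∃ ℓ : ℕ, v - u = (ℓ : ℂ) ∧ ∃ c : ℂ, c ≠ 0 ∧
        ∀ f : (Fin n → ℝ) → ℂ, ContDiffOn ℝ (⊤ : ℕ∞) f V →
        ∀ x ∈ V, x d = 0 →
          D f x = c * juhlOp ε d (u - ((n : ℂ) - 1) / 2) ℓ f x) := by
  obtain ⟨x0, hx, hx0⟩ := hconn.nonempty
  have hx0 : x0 d = 0 := hx0
  let P : MvPolynomial (Fin n) ℂ :=
    ∑ m ∈ multiIdx n N, monomial (Finsupp.equivFunOnFinite.symm m) (a m x0)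
  have hDP : ∀ f, ∀ x ∈ V, x d = 0 → D f x = polyDiff P f x := by
    intro f x hxV hxd
    rw [hD, polyDiff_sum]
    apply Finset.sum_congr rfl
    intro m hm
    rw [polyDiff_monomial]
    have : a m x = a m x0 := const_of_lineDeriv hV hconn.isPreconnected (ha m hm)
      (fun y hy hyd i hi => coeff_lineDeriv hV ha hD h hy hyd hi m hm) ⟨hxV, hxd⟩ ⟨hx, hx0⟩
    rw [this]; rfl
  have hDF : ∀ f, D (pf x0 f) x0 = FlL n P f := fun f => by rw [hDP _ _ hx hx0, polyDiff_pf]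
  have covP : CovFun ε d u (v - u) (FlL n P) := by
    constructor
    · intro f
      have h1 := cov_poly h (kill_eul ε) (by intro w hw; simpa using hw) x0 hx hx0 f
      simp only [hDF, eval_X, eval_C, map_X, map_C, Pi.zero_apply, Complex.ofReal_zero, zero_mul,
        Finset.sum_const_zero, map_add] at h1
      rw [← C_mul, C_mul_smul, map_smul] at h1
      simp at h1
      rw [map_sum]
      linear_combination h1
    · intro i j hi hj hij f
      have h1 := cov_poly h (kill_rot ε i j) (by intro w hw; simp [hi.symm, hj.symm]) x0 hx hx0 f
      have e1 : ∑ k, map Complex.ofRealHom ((if k = j then C (ε i) * X i else 0)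
          - (if k = i then C (ε j) * X j else 0)) * pderiv k f
          + C (u / 2) * map Complex.ofRealHom 0 * f
          = (ε i : ℂ) • (X i * pderiv j f) - (ε j : ℂ) • (X j * pderiv i f) := by
        simp only [map_sub, sub_mul, Finset.sum_sub_distrib, apply_ite (map Complex.ofRealHom),
          map_zero, ite_mul, zero_mul, Finset.sum_ite_eq', Finset.mem_univ, if_true, map_mul, map_C,
          map_X, mul_zero, add_zero, smul_eq_C_mul, mul_assoc]
        rfl
      have e2 : ∀ k, eval (0 : Fin n → ℝ) ((if k = j then C (ε i) * X i else 0)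
          - (if k = i then C (ε j) * X j else 0)) = 0 := by
        intro k; split_ifs <;> simp
      rw [e1, hDF] at h1
      simp only [e2] at h1
      simpa using h1
    · intro i hi f
      have h1 := cov_poly h (kill_spec ε i) (by intro w hw; simp [hi.symm, hw]) x0 hx hx0 f
      have e1 : ∑ k, map Complex.ofRealHom (C (2 * ε i) * (X i * X k)
          - (if k = i then ∑ l, C (ε l) * X l ^ 2 else 0)) * pderiv k f
          + C (u / 2) * map Complex.ofRealHom (C (4 * ε i) * X i) * f
          = (2 * ε i : ℂ) • (X i * ∑ j, X j * pderiv j f)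
      - (∑ j, (ε j : ℂ) • (X j * (X j * pderiv i f))) + (2 * u * ε i) • (X i * f) := by
        simp only [map_sub, sub_mul, Finset.sum_sub_distrib, apply_ite (map Complex.ofRealHom),
          map_zero, ite_mul, zero_mul, Finset.sum_ite_eq', Finset.mem_univ, if_true, map_mul, map_C,
          map_X, smul_eq_C_mul, mul_assoc, map_sum, Finset.mul_sum, Finset.sum_mul, map_pow, pow_two]
        have e3 : (C (u / 2) : MvPolynomial (Fin n) ℂ) * C (Complex.ofRealHom 4) = C 2 * C u := by
          rw [← C_mul, ← C_mul]; congr 1; simp; ring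
        have e4 : (C (Complex.ofRealHom 2) : MvPolynomial (Fin n) ℂ) = C 2 := by simp
        rw [e4, ← mul_assoc (C (u/2)), e3]
        simp only [mul_assoc]
        rfl
      have e2 : ∀ k, eval (0 : Fin n → ℝ) (C (2 * ε i) * (X i * X k)
          - (if k = i then ∑ l, C (ε l) * X l ^ 2 else 0)) = 0 := by
        intro k; split_ifs <;> simp
      rw [e1, hDF] at h1
      simp only [e2] at h1
      simpa using h1
  by_cases hP : P = 0
  · left
    intro f _ x hxV hxd
    rw [hDP f x hxV hxd, hP, polyDiff_zero]
  right
  obtain ⟨m, hm⟩ := MvPolynomial.ne_zero_iff.1 hP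
  have hl : ((m.degree : ℕ) : ℂ) = v - u := by
    by_contra hne
    have := covP.H m hne
    rw [FlL_right] at this
    exact (mul_ne_zero (prodfac_ne m) hm) this
  refine ⟨m.degree, hl.symm, ?_⟩
  generalize m.degree = ℓ at hl
  rw [← hl] at covP
  have covJ := juhl_cov ε hε d u ℓ
  set J := juhlSymbol ε d (u - ((n : ℂ) - 1) / 2) ℓ with hJ
  set ms : Fin n →₀ ℕ := Finsupp.single i1 (2 * (ℓ / 2)) + Finsupp.single d (ℓ % 2) with hms
  have hJne : FlL n J (monomial ms 1) ≠ 0 := by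
    intro h0
    exact juhl_ne ε hε d i1 hi1 _ ℓ (FlL_inj _ (covJ.vanish hε ℓ i1 i2 hi1 hi2 hi12 h0))
  set t := FlL n P (monomial ms 1) / FlL n J (monomial ms 1) with ht
  have hz : FlL n P - t • FlL n J = 0 := by
    refine (covP.sub_smul covJ t).vanish hε ℓ i1 i2 hi1 hi2 hi12 ?_
    rw [← hms, LinearMap.sub_apply, LinearMap.smul_apply, smul_eq_mul, ht, div_mul_cancel₀ _ hJne,
      sub_self]
  have hPJ : P = C t * J := by
    rw [← sub_eq_zero]
    apply FlL_inj
    rw [map_sub, C_mul_smul, map_smul, hz]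
  refine ⟨t, ?_, ?_⟩
  · intro h0
    apply hP
    rw [hPJ, h0]; simp
  · intro f hf x hxV hxd
    rw [hDP f x hxV hxd, hPJ, polyDiff_C_mul, juhlOp_eq hV hf ε d _ ℓ hxV]

end Helpers

theorem stmt5 (n : ℕ) (hn : 3 ≤ n) (ε : Fin n → ℝ) (hε : ∀ j, ε j = 1 ∨ ε j = -1)
    (u v : ℂ) (V : Set (Fin n → ℝ)) (hV : IsOpen V)
    (hne : (V ∩ {x | x ⟨n - 1, by omega⟩ = 0}).Nonempty)
    (hconn : IsConnected (V ∩ {x | x ⟨n - 1, by omega⟩ = 0}))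
    (N : ℕ) (a : (Fin n → ℕ) → (Fin n → ℝ) → ℂ)
    (ha : ∀ m ∈ multiIdx n N,
      ContDiffOn ℝ (⊤ : ℕ∞) (a m) (V ∩ {x | x ⟨n - 1, by omega⟩ = 0}))
    (D : ((Fin n → ℝ) → ℂ) → (Fin n → ℝ) → ℂ)
    (hD : ∀ f x, D f x = ∑ m ∈ multiIdx n N, a m x * monoDiff m f x)
    (hcov : ∀ (Z : (Fin n → ℝ) → (Fin n → ℝ)) (ρ : (Fin n → ℝ) → ℝ),
      IsConformalKillingPair ε V Z ρ →
      (∀ x ∈ V, x ⟨n - 1, by omega⟩ = 0 → Z x ⟨n - 1, by omega⟩ = 0) →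
      ∀ f : (Fin n → ℝ) → ℂ, ContDiffOn ℝ (⊤ : ℕ∞) f V →
      ∀ x ∈ V, x ⟨n - 1, by omega⟩ = 0 →
        D (fun y => (∑ j, (Z y j : ℂ) * pd j f y) + u / 2 * (ρ y : ℂ) * f y) x
          = (∑ j ∈ Finset.univ.erase ⟨n - 1, by omega⟩,
              (Z x j : ℂ) * lineDeriv ℝ (D f) x (Pi.single j 1))
            + v / 2 * (ρ x : ℂ) * D f x) :
    (∀ f : (Fin n → ℝ) → ℂ, ContDiffOn ℝ (⊤ : ℕ∞) f V →
        ∀ x ∈ V, x ⟨n - 1, by omega⟩ = 0 → D f x = 0) ∨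
    (∃ ℓ : ℕ, v - u = (ℓ : ℂ) ∧ ∃ c : ℂ, c ≠ 0 ∧
        ∀ f : (Fin n → ℝ) → ℂ, ContDiffOn ℝ (⊤ : ℕ∞) f V →
        ∀ x ∈ V, x ⟨n - 1, by omega⟩ = 0 →
          D f x = c * juhlOp ε ⟨n - 1, by omega⟩ (u - ((n : ℂ) - 1) / 2) ℓ f x) := by
  exact main_gen ε hε ⟨n - 1, by omega⟩ ⟨0, by omega⟩ ⟨1, by omega⟩
    (by simp [Fin.ext_iff]; omega) (by simp [Fin.ext_iff]; omega) (by simp [Fin.ext_iff])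
    u v V hV hconn N a ha D hD hcov
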